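/- arXiv:1811.05959 — 9 statements merged into one kernel-verified Lean document; each statement's English description precedes it below -/
import Mathlib

section
/- Let X ⊆ ℝ^N be a Borel set, μ a Borel σ-finite measure on X, and T : X → X an injective, locally Lipschitz map such that μ is T-invariant (μ(T^{-1}Y) = μ(Y) for all Borel Y ⊆ X) and ergodic (every Borel set Y ⊆ X with T^{-1}Y = Y satisfies μ(Y) = 0 or μ(X ∖ Y) = 0). Take k ∈ ℕ and β ∈ (0,1] such that H^{βk}(X) = 0. Let h : X → ℝ be locally β-Hölder and let h_1,…,h_m : X → ℝ be a 2k-interpolating family on X consisting of locally β-Hölder functions; for α ∈ ℝ^m set h_α = h + Σ_{j=1}^m α_j h_j. Then (without any assumption on the periodic points of T) for Lebesgue almost every α ∈ ℝ^m there exists a Borel set X_α ⊆ X of full μ-measure such that the delay-coordinate map φ_α^T(x) = (h_α(x), h_α(Tx), …, h_α(T^{k−1}x)) is injective on X_α. -/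
open MeasureTheory Set
open scoped InnerProductSpace ENNReal

/-- `h₁,…,h_m` form a `K`-interpolating family on `X` if for every `l ≤ K` and all distinct
points `x₁,…,x_l ∈ X`, the `l × m` matrix `(h_j(x_i))_{i,j}` has full row rank `l`. -/
def IsInterpolatingFamily {E : Type*} {m : ℕ} (X : Set E) (h : Fin m → E → ℝ) (K : ℕ) : Prop :=
  ∀ l : ℕ, l ≤ K → ∀ x : Fin l → E, (∀ i, x i ∈ X) → Function.Injective x →
    (Matrix.of fun i j => h j (x i)).rank = l

/-- `Per_p(T)` within `X`: points of minimal period `p`. -/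
def PerSet {E : Type*} (T : E → E) (X : Set E) (p : ℕ) : Set E :=
  {x ∈ X | T^[p] x = x ∧ ∀ j : ℕ, 1 ≤ j → j < p → T^[j] x ≠ x}

/-- `f` is locally `β`-Hölder on `X`. -/
def LocallyHolderOn {E F : Type*} [NormedAddCommGroup E] [NormedAddCommGroup F]
    (β : ℝ) (f : E → F) (X : Set E) : Prop :=
  ∀ x ∈ X, ∃ U : Set E, IsOpen U ∧ x ∈ U ∧
    ∃ C > (0 : ℝ), ∀ y ∈ U ∩ X, ∀ y' ∈ U ∩ X, ‖f y - f y'‖ ≤ C * ‖y - y'‖ ^ β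

namespace TakensAux
open Filter Topology NNReal

variable {E F G : Type*} [NormedAddCommGroup E] [NormedAddCommGroup F] [NormedAddCommGroup G]

lemma lh_mono {β : ℝ} {f : E → F} {X Y : Set E} (hf : LocallyHolderOn β f X) (hYX : Y ⊆ X) :
    LocallyHolderOn β f Y := by
  intro x hx
  obtain ⟨U, hU, hxU, C, hC, h⟩ := hf x (hYX hx)
  exact ⟨U, hU, hxU, C, hC, fun y hy y' hy' => h y ⟨hy.1, hYX hy.2⟩ y' ⟨hy'.1, hYX hy'.2⟩⟩

lemma lh_const_sub {β : ℝ} {f : E → F} {X : Set E} (hf : LocallyHolderOn β f X) (c : F) :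
    LocallyHolderOn β (fun y => c - f y) X := by
  intro x hx
  obtain ⟨U, hU, hxU, C, hC, h⟩ := hf x hx
  refine ⟨U, hU, hxU, C, hC, fun y hy y' hy' => ?_⟩
  have := h y hy y' hy'
  rwa [sub_sub_sub_cancel_left, norm_sub_rev]

lemma lh_clm [NormedSpace ℝ F] [NormedSpace ℝ G] {β : ℝ} {f : E → F} {X : Set E}
    (hf : LocallyHolderOn β f X) (L : F →L[ℝ] G) :
    LocallyHolderOn β (fun y => L (f y)) X := by
  intro x hx
  obtain ⟨U, hU, hxU, C, hC, h⟩ := hf x hx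
  refine ⟨U, hU, hxU, (‖L‖ + 1) * C, by positivity, fun y hy y' hy' => ?_⟩
  have h1 := h y hy y' hy'
  rw [← map_sub]
  calc ‖L (f y - f y')‖ ≤ ‖L‖ * ‖f y - f y'‖ := L.le_opNorm _
    _ ≤ (‖L‖ + 1) * (C * ‖y - y'‖ ^ β) := by gcongr; linarith
    _ = _ := by ring

lemma lh_pi {ι : Type*} [Fintype ι] {β : ℝ} {f : ι → E → F} {X : Set E}
    (hf : ∀ i, LocallyHolderOn β (f i) X) :
    LocallyHolderOn β (fun y i => f i y) X := by
  intro x hx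
  choose U hU hxU C hC h using fun i => hf i x hx
  refine ⟨⋂ i, U i, isOpen_iInter_of_finite hU, mem_iInter.2 hxU, ∑ i, C i + 1,
    by have := Finset.sum_nonneg (s := Finset.univ) (fun i _ => (hC i).le); linarith,
    fun y hy y' hy' => ?_⟩
  have hs := Finset.sum_nonneg (s := Finset.univ) (fun i _ => (hC i).le)
  refine (pi_norm_le_iff_of_nonneg (by positivity)).2 fun i => ?_
  refine (h i y ⟨mem_iInter.1 hy.1 i, hy.2⟩ y' ⟨mem_iInter.1 hy'.1 i, hy'.2⟩).trans ?_
  gcongr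
  have := Finset.single_le_sum (f := C) (fun i _ => (hC i).le) (Finset.mem_univ i)
  linarith

lemma lh_cont {β : ℝ} (hβ : 0 < β) {f : E → F} {X : Set E} (hf : LocallyHolderOn β f X) :
    ContinuousOn f X := by
  intro x hx
  obtain ⟨U, hU, hxU, C, hC, h⟩ := hf x hx
  rw [ContinuousWithinAt, tendsto_iff_norm_sub_tendsto_zero]
  have h1 : Tendsto (fun y => C * ‖y - x‖ ^ β) (𝓝[X] x) (𝓝 0) := by
    have : Continuous (fun y => C * ‖y - x‖ ^ β) := by
      refine continuous_const.mul (Continuous.rpow_const (by fun_prop) (fun _ => Or.inr hβ.le))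
    have h2 := (this.tendsto x).mono_left (nhdsWithin_le_nhds (s := X))
    simpa [Real.zero_rpow hβ.ne'] using h2
  refine squeeze_zero' (Eventually.of_forall fun _ => norm_nonneg _) ?_ h1
  filter_upwards [self_mem_nhdsWithin, mem_nhdsWithin_of_mem_nhds (hU.mem_nhds hxU)] with y hy hyU
  exact h y ⟨hyU, hy⟩ x ⟨hxU, hx⟩

lemma lh_comp {β : ℝ} (hβ : 0 < β) {T : E → E} {f : E → F} {X : Set E} (hT : LocallyHolderOn 1 T X)
    (hTX : MapsTo T X X) (hf : LocallyHolderOn β f X) :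
    LocallyHolderOn β (fun y => f (T y)) X := by
  intro x hx
  obtain ⟨U, hU, hxU, C, hC, h⟩ := hf (T x) (hTX hx)
  obtain ⟨V, hV, hxV, D, hD, h'⟩ := hT x hx
  obtain ⟨W, hW, hWU⟩ := (continuousOn_iff'.1 (lh_cont one_pos hT)) U hU
  have hxW : x ∈ W ∩ X := hWU ▸ ⟨hxU, hx⟩
  have key : ∀ y, y ∈ W → y ∈ X → T y ∈ U := fun y h1 h2 => by
    have : y ∈ T ⁻¹' U ∩ X := hWU ▸ ⟨h1, h2⟩
    exact this.1
  refine ⟨V ∩ W, hV.inter hW, ⟨hxV, hxW.1⟩, C * D ^ β, by positivity, fun y hy y' hy' => ?_⟩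
  have h1 := h _ ⟨key y hy.1.2 hy.2, hTX hy.2⟩ _ ⟨key y' hy'.1.2 hy'.2, hTX hy'.2⟩
  have h2 := h' y ⟨hy.1.1, hy.2⟩ y' ⟨hy'.1.1, hy'.2⟩
  rw [Real.rpow_one] at h2
  calc _ ≤ _ := h1
    _ ≤ C * (D * ‖y - y'‖) ^ β := by gcongr
    _ = _ := by rw [Real.mul_rpow hD.le (norm_nonneg _)]; ring

lemma lh_iter {β : ℝ} (hβ : 0 < β) {T : E → E} {X : Set E} (hT : LocallyHolderOn 1 T X)
    (hTX : MapsTo T X X) (i : ℕ) {f : E → F} (hf : LocallyHolderOn β f X) :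
    LocallyHolderOn β (fun y => f (T^[i] y)) X := by
  induction i with
  | zero => simpa using hf
  | succ i ih => exact lh_comp (f := fun y => f (T^[i] y)) hβ hT hTX ih

/-- A relation which is Hölder has null image. -/
lemma null_of_holder_rel [MeasurableSpace E] [BorelSpace E] {β : ℝ} (hβ : 0 < β) {k : ℕ}
    {Y : Set E} (hY : μH[β * k] Y = 0)
    (R : E → (Fin k → ℝ) → Prop) (C : ℝ)
    (hR : ∀ y ∈ Y, ∀ y' ∈ Y, ∀ t t', R y t → R y' t' → ‖t - t'‖ ≤ C * ‖y - y'‖ ^ β) :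
    volume {t | ∃ y ∈ Y, R y t} = 0 := by
  classical
  let Z : Set E := {y ∈ Y | ∃ t, R y t}
  have : ∀ y, ∃ t, y ∈ Z → R y t := fun y => by
    by_cases hy : y ∈ Z
    · exact ⟨hy.2.choose, fun _ => hy.2.choose_spec⟩
    · exact ⟨0, fun h => absurd h hy⟩
  choose g hg using this
  have hsub : {t | ∃ y ∈ Y, R y t} ⊆ g '' Z := by
    rintro t ⟨y, hy, ht⟩
    refine ⟨y, ⟨hy, t, ht⟩, ?_⟩
    have := hR y hy y hy _ _ (hg y ⟨hy, t, ht⟩) ht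
    rw [sub_self, norm_zero, Real.zero_rpow hβ.ne', mul_zero] at this
    exact sub_eq_zero.1 (norm_le_zero_iff.1 this)
  have hH : HolderOnWith C.toNNReal β.toNNReal g Z := by
    intro y hy y' hy'
    have h1 := hR y hy.1 y' hy'.1 _ _ (hg y hy) (hg y' hy')
    rw [edist_dist, edist_dist, dist_eq_norm, dist_eq_norm, Real.coe_toNNReal _ hβ.le,
      ENNReal.ofReal_rpow_of_nonneg (norm_nonneg _) hβ.le, ← ENNReal.ofReal,
      ← ENNReal.ofReal_mul' (by positivity)]
    exact ENNReal.ofReal_le_ofReal h1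
  have h2 := hH.hausdorffMeasure_image_le (by simpa using hβ) (d := (k : ℝ)) (by positivity)
  rw [Real.coe_toNNReal _ hβ.le] at h2
  have h3 : μH[β * k] Z = 0 := measure_mono_null (fun y hy => hy.1) hY
  rw [h3, mul_zero] at h2
  have h4 : (μH[(k : ℝ)] : Measure (Fin k → ℝ)) = volume := by
    simpa using hausdorffMeasure_pi_real (ι := Fin k)
  rw [h4] at h2
  exact measure_mono_null hsub (le_antisymm h2 (zero_le))

/-- Slicing: a measurable set whose slices along `S` are null is null. -/
lemma null_of_slices {k m : ℕ} {A : Set (Fin m → ℝ)} (hA : MeasurableSet A)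
    (S : (Fin k → ℝ) →L[ℝ] (Fin m → ℝ))
    (h : ∀ a, volume {t | a + S t ∈ A} = 0) : volume A = 0 := by
  have hm : Measurable (fun p : (Fin m → ℝ) × (Fin k → ℝ) => p.1 + S p.2) := by fun_prop
  have h0 : ((volume : Measure (Fin m → ℝ)).prod (volume : Measure (Fin k → ℝ)))
      ((fun p : (Fin m → ℝ) × (Fin k → ℝ) => p.1 + S p.2) ⁻¹' A) = 0 :=
    Measure.measure_prod_null_of_ae_null (hm hA) (Eventually.of_forall fun a => h a)
  rw [Measure.prod_apply_symm (hm hA)] at h0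
  have h1 : ∀ t : Fin k → ℝ, volume ((fun x : Fin m → ℝ => (x, t)) ⁻¹'
      ((fun p : (Fin m → ℝ) × (Fin k → ℝ) => p.1 + S p.2) ⁻¹' A)) = volume A := fun t =>
    measure_preimage_add_right volume (S t) A
  simp_rw [h1] at h0
  rw [lintegral_const] at h0
  rcases mul_eq_zero.1 h0 with h | h
  · exact h
  · exact absurd h (by simp [NeZero.ne])

lemma sc_inter {A B : Type*} [TopologicalSpace A] [T2Space A] [TopologicalSpace B] {s : Set A}
    (hs : IsSigmaCompact s) {f : A → B} (hf : ContinuousOn f s) {C : Set B} (hC : IsClosed C) :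
    IsSigmaCompact (s ∩ f ⁻¹' C) := by
  obtain ⟨K, hK, rfl⟩ := hs
  rw [iUnion_inter]
  refine isSigmaCompact_iUnion_of_isCompact _ fun n => ?_
  exact (hK n).of_isClosed_subset
    ((hf.mono (subset_iUnion K n)).preimage_isClosed_of_isClosed (hK n).isClosed hC)
    inter_subset_left

lemma sc_prod {A B : Type*} [TopologicalSpace A] [TopologicalSpace B] {s : Set A} {t : Set B}
    (hs : IsSigmaCompact s) (ht : IsSigmaCompact t) : IsSigmaCompact (s ×ˢ t) := by
  obtain ⟨K, hK, rfl⟩ := hs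
  obtain ⟨L, hL, rfl⟩ := ht
  have : (⋃ n, K n) ×ˢ (⋃ n, L n) = ⋃ i, ⋃ j, K i ×ˢ L j := by
    ext p; simp
  rw [this]
  exact isSigmaCompact_iUnion _ fun i => isSigmaCompact_iUnion_of_isCompact _ fun j => (hK i).prod (hL j)

lemma sc_meas {A : Type*} [TopologicalSpace A] [T2Space A] [MeasurableSpace A]
    [OpensMeasurableSpace A] {s : Set A} (hs : IsSigmaCompact s) : MeasurableSet s := by
  obtain ⟨K, hK, rfl⟩ := hs
  exact MeasurableSet.iUnion fun n => (hK n).measurableSet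

lemma sc_open {A : Type*} [MetricSpace A] {s : Set A} (hs : IsSigmaCompact s) {U : Set A}
    (hU : IsOpen U) : IsSigmaCompact (s ∩ U) := by
  obtain ⟨F, hF, -, h, -⟩ := hU.exists_iUnion_isClosed
  rw [← h, inter_iUnion]
  exact isSigmaCompact_iUnion _ fun n => sc_inter hs continuousOn_id (hF n)

end TakensAux
namespace TakensAux
open Filter Topology NNReal

variable {E : Type*} [NormedAddCommGroup E]

lemma null_fiber [SecondCountableTopology E] [MeasurableSpace E] [BorelSpace E] {β : ℝ}
    (hβ : 0 < β) {k m : ℕ} {Y : Set E} (hYs : IsSigmaCompact Y) (hY : μH[β * k] Y = 0)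
    (w : E → Fin k → ℝ) (D : E → ((Fin m → ℝ) →L[ℝ] (Fin k → ℝ)))
    (hw : LocallyHolderOn β w Y) (hD : LocallyHolderOn β D Y)
    (hsurj : ∀ y ∈ Y, Function.Surjective (D y)) :
    volume {α | ∃ y ∈ Y, w y + D y α = 0} = 0 := by
  have hwc := lh_cont hβ hw
  have hDc := lh_cont hβ hD
  have loc : ∀ y₀ ∈ Y, ∃ U, IsOpen U ∧ y₀ ∈ U ∧
      volume {α | ∃ y ∈ Y ∩ U, w y + D y α = 0} = 0 := by
    intro y₀ hy₀
    obtain ⟨S, hS⟩ := (D y₀).exists_rightInverse_of_surjective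
      (LinearMap.range_eq_top.2 (hsurj y₀ hy₀))
    have hc : ContinuousOn (fun y => (D y).comp S - ContinuousLinearMap.id ℝ (Fin k → ℝ)) Y := by
      fun_prop
    have hc0 := hc y₀ hy₀
    have hball := hc0 (Metric.ball_mem_nhds _ (show (0:ℝ) < 1/2 by norm_num))
    rw [mem_map, mem_nhdsWithin] at hball
    obtain ⟨U1, hU1, hy1, hsub⟩ := hball
    obtain ⟨U2, hU2, hy2, C2, hC2, h2⟩ := hw y₀ hy₀
    obtain ⟨U3, hU3, hy3, C3, hC3, h3⟩ := hD y₀ hy₀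
    refine ⟨U1 ∩ U2 ∩ U3, (hU1.inter hU2).inter hU3, ⟨⟨hy1, hy2⟩, hy3⟩, ?_⟩
    set U := U1 ∩ U2 ∩ U3 with hUdef
    have hUo : IsOpen U := (hU1.inter hU2).inter hU3
    have hmeas : MeasurableSet {α | ∃ y ∈ Y ∩ U, w y + D y α = 0} := by
      have hfc : ContinuousOn (fun p : E × (Fin m → ℝ) => w p.1 + D p.1 p.2)
          ((Y ∩ U) ×ˢ univ) := by
        have hm : MapsTo (Prod.fst : E × (Fin m → ℝ) → E) ((Y ∩ U) ×ˢ univ) Y :=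
          fun p hp => hp.1.1
        have a1 := hwc.comp continuousOn_fst hm
        have a2 := hDc.comp continuousOn_fst hm
        exact a1.add (a2.clm_apply continuousOn_snd)
      have h1 := sc_inter (sc_prod (sc_open hYs hUo) isSigmaCompact_univ) hfc
        (isClosed_singleton (x := (0 : Fin k → ℝ)))
      have h2 := sc_meas (h1.image continuous_snd)
      convert h2 using 1
      ext α
      constructor
      · rintro ⟨y, hy, h⟩
        exact ⟨(y, α), ⟨⟨hy, mem_univ _⟩, h⟩, rfl⟩
      · rintro ⟨⟨y, α'⟩, ⟨⟨hy, -⟩, h⟩, rfl⟩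
        exact ⟨y, hy, h⟩
    refine null_of_slices hmeas S fun a => ?_
    have hcov : {t | a + S t ∈ {α | ∃ y ∈ Y ∩ U, w y + D y α = 0}} ⊆
        ⋃ n : ℕ, {t | ∃ y ∈ Y ∩ U, ‖t‖ ≤ n ∧ w y + D y (a + S t) = 0} := by
      rintro t ⟨y, hy, ht⟩
      obtain ⟨n, hn⟩ := exists_nat_ge ‖t‖
      exact mem_iUnion.2 ⟨n, y, hy, hn, ht⟩
    refine measure_mono_null hcov (measure_iUnion_null fun n => ?_)
    refine null_of_holder_rel hβ (measure_mono_null inter_subset_left hY)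
      (fun y t => ‖t‖ ≤ n ∧ w y + D y (a + S t) = 0) (2 * (C2 + C3 * (‖a‖ + ‖S‖ * n))) ?_
    rintro y ⟨hy, hyU⟩ y' ⟨hy', hyU'⟩ t t' ⟨-, ht⟩ ⟨htn', ht'⟩
    have e1 : ‖(D y).comp S - ContinuousLinearMap.id ℝ (Fin k → ℝ)‖ ≤ 1 / 2 := by
      have := hsub ⟨hyU.1.1, hy⟩
      simp only [mem_preimage, hS, sub_self, mem_ball_zero_iff] at this
      exact this.le
    have e2 := h2 y ⟨hyU.1.2, hy⟩ y' ⟨hyU'.1.2, hy'⟩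
    have e3 := h3 y ⟨hyU.2, hy⟩ y' ⟨hyU'.2, hy'⟩
    have e4 : D y (S (t - t')) = -(w y - w y') - (D y - D y') (a + S t') := by
      have q1 : D y a + D y (S t) = - w y := by
        rw [map_add] at ht; exact eq_neg_of_add_eq_zero_right ht
      have q2 : D y' a + D y' (S t') = - w y' := by
        rw [map_add] at ht'; exact eq_neg_of_add_eq_zero_right ht'
      rw [_root_.sub_apply, map_sub, map_sub, map_add, map_add, q2,
        eq_sub_of_add_eq' q1]
      abel
    have e5 : t - t' = D y (S (t - t')) -
        ((D y).comp S - ContinuousLinearMap.id ℝ (Fin k → ℝ)) (t - t') := by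
      simp
    have e6 : ‖((D y).comp S - ContinuousLinearMap.id ℝ (Fin k → ℝ)) (t - t')‖
        ≤ 1 / 2 * ‖t - t'‖ := ContinuousLinearMap.le_of_opNorm_le _ e1 _
    have e7 : ‖D y (S (t - t'))‖ ≤ C2 * ‖y - y'‖ ^ β + (C3 * ‖y - y'‖ ^ β) * (‖a‖ + ‖S‖ * n) := by
      rw [e4]
      refine (norm_sub_le _ _).trans ?_
      rw [norm_neg]
      refine add_le_add e2 ((ContinuousLinearMap.le_of_opNorm_le _ e3 _).trans ?_)
      gcongr
      refine (norm_add_le _ _).trans ?_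
      gcongr
      refine (S.le_opNorm _).trans ?_
      gcongr
    have e8 : ‖t - t'‖ ≤ ‖D y (S (t - t'))‖ +
        ‖((D y).comp S - ContinuousLinearMap.id ℝ (Fin k → ℝ)) (t - t')‖ := by
      conv_lhs => rw [e5]
      exact norm_sub_le _ _
    nlinarith
  choose! U hUo hyU hU0 using loc
  obtain ⟨s, hsY, hsc, hcov⟩ := TopologicalSpace.countable_cover_nhdsWithin (s := Y) (f := U)
    (fun y hy => mem_nhdsWithin_of_mem_nhds ((hUo y hy).mem_nhds (hyU y hy)))
  refine measure_mono_null (t := ⋃ y₀ ∈ s, {α | ∃ y ∈ Y ∩ U y₀, w y + D y α = 0}) ?_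
    ((measure_biUnion_null_iff hsc).2 fun y₀ h => hU0 y₀ (hsY h))
  rintro α ⟨y, hy, h⟩
  obtain ⟨y₀, hy₀, hyy⟩ := mem_iUnion₂.1 (hcov hy)
  exact mem_iUnion₂.2 ⟨y₀, hy₀, y, ⟨hy, hyy⟩, h⟩

/-- a.e. injectivity. -/
lemma ae_inj [SecondCountableTopology E] [CompleteSpace E] [MeasurableSpace E] [BorelSpace E]
    {β : ℝ}
    (hβ : 0 < β) {k m : ℕ} {Y : Set E} (hYm : MeasurableSet Y) (hY : μH[β * k] Y = 0)
    (μ : Measure E) [SigmaFinite μ]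
    (v : E → Fin k → ℝ) (V : E → ((Fin m → ℝ) →L[ℝ] (Fin k → ℝ)))
    (hv : LocallyHolderOn β v Y) (hV : LocallyHolderOn β V Y)
    (hsurj : ∀ x ∈ Y, ∀ y ∈ Y, x ≠ y → Function.Surjective (V x - V y)) :
    ∀ᵐ α ∂(volume : Measure (Fin m → ℝ)), ∃ Z ⊆ Y, MeasurableSet Z ∧ μ (Y \ Z) = 0 ∧
      InjOn (fun x => v x + V x α) Z := by
  -- a sigma-compact subset of full measure
  obtain ⟨Q, hQY, hQs, hQ0⟩ : ∃ Q ⊆ Y, IsSigmaCompact Q ∧ μ (Y \ Q) = 0 := by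
    have : ∀ n : ℕ, ∃ K ⊆ Y, IsCompact K ∧ μ.toFinite (Y \ K) < ((n : ℝ≥0∞) + 1)⁻¹ := fun n => by
      obtain ⟨K, h1, h2, h3⟩ := hYm.exists_isCompact_sdiff_lt (μ := μ.toFinite)
        (measure_ne_top _ _) (ε := ((n : ℝ≥0∞) + 1)⁻¹) (by simp)
      exact ⟨K, h1, h2, h3⟩
    choose K hKY hK hKl using this
    refine ⟨⋃ n, K n, iUnion_subset hKY, isSigmaCompact_iUnion_of_isCompact _ hK, ?_⟩
    apply absolutelyContinuous_toFinite μ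
    refine le_antisymm (ENNReal.le_of_forall_pos_le_add fun ε hε _ => ?_) zero_le
    obtain ⟨n, hn⟩ := ENNReal.exists_inv_nat_lt (a := (ε : ℝ≥0∞)) (by simpa using hε.ne')
    rw [zero_add]
    calc μ.toFinite (Y \ ⋃ n, K n) ≤ μ.toFinite (Y \ K n) :=
          measure_mono (sdiff_subset_sdiff_right (subset_iUnion K n))
      _ ≤ ((n : ℝ≥0∞) + 1)⁻¹ := (hKl n).le
      _ ≤ (n : ℝ≥0∞)⁻¹ := ENNReal.inv_le_inv.2 le_self_add
      _ ≤ ε := hn.le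
  have hvc := (lh_cont hβ hv).mono hQY
  have hVc := (lh_cont hβ hV).mono hQY
  let B : Set (E × (Fin m → ℝ)) := {p | p.1 ∈ Q ∧ ∃ y ∈ Q, y ≠ p.1 ∧
    (v p.1 - v y) + (V p.1 - V y) p.2 = 0}
  have hB : MeasurableSet B := by
    have s1 : IsSigmaCompact ((Q ×ˢ (Q ×ˢ (univ : Set (Fin m → ℝ)))) ∩ {p | p.2.1 ≠ p.1}) :=
      sc_open (sc_prod hQs (sc_prod hQs isSigmaCompact_univ))
        (isOpen_ne_fun (by fun_prop) (by fun_prop))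
    have hfc : ContinuousOn (fun p : E × E × (Fin m → ℝ) =>
        (v p.1 - v p.2.1) + (V p.1 - V p.2.1) p.2.2)
        ((Q ×ˢ (Q ×ˢ (univ : Set (Fin m → ℝ)))) ∩ {p | p.2.1 ≠ p.1}) := by
      set W := ((Q ×ˢ (Q ×ˢ (univ : Set (Fin m → ℝ)))) ∩ {p | p.2.1 ≠ p.1})
      have m1 : MapsTo (fun p : E × E × (Fin m → ℝ) => p.1) W Q := fun p hp => hp.1.1
      have m2 : MapsTo (fun p : E × E × (Fin m → ℝ) => p.2.1) W Q := fun p hp => hp.1.2.1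
      have c1 : ContinuousOn (fun p : E × E × (Fin m → ℝ) => p.1) W := by fun_prop
      have c2 : ContinuousOn (fun p : E × E × (Fin m → ℝ) => p.2.1) W := by fun_prop
      have c3 : ContinuousOn (fun p : E × E × (Fin m → ℝ) => p.2.2) W := by fun_prop
      exact ((hvc.comp c1 m1).sub (hvc.comp c2 m2)).add
        (((hVc.comp c1 m1).sub (hVc.comp c2 m2)).clm_apply c3)
    have s2 := sc_inter s1 hfc (isClosed_singleton (x := (0 : Fin k → ℝ)))
    have s3 := sc_meas (s2.image (f := fun p : E × E × (Fin m → ℝ) => (p.1, p.2.2)) (by fun_prop))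
    convert s3 using 1
    ext ⟨x, α⟩
    constructor
    · rintro ⟨hx, y, hy, hne, h⟩
      exact ⟨(x, y, α), ⟨⟨⟨hx, hy, mem_univ _⟩, hne⟩, h⟩, rfl⟩
    · rintro ⟨⟨x', y, α'⟩, ⟨⟨⟨hx, hy, -⟩, hne⟩, h⟩, heq⟩
      obtain ⟨rfl, rfl⟩ := Prod.mk.inj heq
      exact ⟨hx, y, hy, hne, h⟩
  have hslice : ∀ x, volume (Prod.mk x ⁻¹' B) = 0 := by
    intro x
    by_cases hx : x ∈ Q
    · have hsub : Q ∩ {x}ᶜ ⊆ Y := fun y hy => hQY hy.1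
      have := null_fiber hβ (Y := Q ∩ {x}ᶜ) (sc_open hQs isOpen_compl_singleton)
        (measure_mono_null hsub hY) (fun y => v x - v y) (fun y => V x - V y)
        (lh_const_sub (lh_mono hv hsub) _) (lh_const_sub (lh_mono hV hsub) _)
        (fun y hy => hsurj x (hQY hx) y (hQY hy.1) (fun h => hy.2 h.symm))
      refine measure_mono_null ?_ this
      rintro α ⟨-, y, hy, hne, h⟩
      exact ⟨y, ⟨hy, hne⟩, h⟩
    · refine measure_mono_null (t := ∅) ?_ measure_empty
      rintro α ⟨h, -⟩
      exact hx h
  have hnull : (μ.prod volume) B = 0 :=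
    Measure.measure_prod_null_of_ae_null hB (Eventually.of_forall hslice)
  have hnull' : ((volume : Measure (Fin m → ℝ)).prod μ) (Prod.swap ⁻¹' B) = 0 := by
    rw [← Measure.prod_swap, Measure.map_apply measurable_swap hB] at hnull
    exact hnull
  have hae := Measure.measure_ae_null_of_prod_null hnull'
  filter_upwards [hae] with α hα
  have hBα : MeasurableSet {x | (x, α) ∈ B} := measurable_prodMk_right hB
  refine ⟨Q \ {x | (x, α) ∈ B}, fun x hx => hQY hx.1, (sc_meas hQs).diff hBα, ?_, ?_⟩
  · refine measure_mono_null (t := (Y \ Q) ∪ {x | (x, α) ∈ B}) ?_ (measure_union_null hQ0 hα)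
    intro x hx
    by_cases hxQ : x ∈ Q
    · right
      by_contra h
      exact hx.2 ⟨hxQ, h⟩
    · exact Or.inl ⟨hx.1, hxQ⟩
  · intro x hx y hy hxy
    by_contra hne
    refine hx.2 ⟨hx.1, y, hy.1, fun h => hne h.symm, ?_⟩
    simp only at hxy
    rw [_root_.sub_apply]
    rw [sub_add_sub_comm, hxy, sub_self]

end TakensAux
namespace TakensAux
open Filter Topology NNReal

lemma interp_finset {E : Type*} {m K : ℕ} {X : Set E} {h : Fin m → E → ℝ}
    (hI : IsInterpolatingFamily X h K) (P : Finset E) (hP : ↑P ⊆ X) (hc : P.card ≤ K)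
    (d : E → ℝ) (hd : ∀ j, ∑ p ∈ P, d p * h j p = 0) : ∀ p ∈ P, d p = 0 := by
  let e := P.equivFin.symm
  let x : Fin P.card → E := fun i => (e i : E)
  have hr := hI P.card hc x (fun i => hP (e i).2)
    (Subtype.val_injective.comp e.injective)
  rw [Matrix.rank_eq_finrank_span_row] at hr
  have hli : LinearIndependent ℝ (Matrix.of fun i j => h j (x i)).row := by
    rw [linearIndependent_iff_card_eq_finrank_span, Fintype.card_fin]
    exact hr.symm
  have h0 := Fintype.linearIndependent_iff.1 hli (fun i => d (x i)) (by
    ext j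
    rw [Finset.sum_apply]
    have : ∑ i, d (x i) * h j (x i) = ∑ p ∈ P, d p * h j p := by
      rw [← Finset.sum_coe_sort P]
      exact Equiv.sum_comp e (fun q : P => d q * h j q)
    simpa [Matrix.row, hd j] using this)
  intro p hp
  have := h0 (e.symm ⟨p, hp⟩)
  simpa [x] using this

lemma comb_half {E : Type*} [DecidableEq E] {T : E → E} {X : Set E} (hTX : MapsTo T X X)
    (hT : InjOn T X)
    {x y : E} (hx : x ∈ X) (hy : y ∈ X) (hap : ∀ p, 0 < p → T^[p] x ≠ x)
    {k : ℕ} {c : Fin k → ℝ} {i : Fin k} (hi : c i ≠ 0) (hmin : ∀ i', c i' ≠ 0 → i ≤ i')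
    (heq : ∑ l : Fin k, (if T^[l] x = T^[i] x then c l else 0) =
      ∑ l : Fin k, (if T^[l] y = T^[i] x then c l else 0)) : ∃ a, T^[a] y = x := by
  have hinj : ∀ a b : ℕ, a ≤ b → ∀ z ∈ X, ∀ z' ∈ X, T^[b] z' = T^[a] z → T^[b - a] z' = z := by
    intro a b hab z hz z' hz' h
    have h1 : T^[b] z' = T^[a] (T^[b - a] z') := by
      rw [← Function.iterate_add_apply, Nat.add_sub_cancel' hab]
    rw [h1] at h
    exact hT.iterate hTX a (hTX.iterate _ hz') hz h
  have hl : ∑ l : Fin k, (if T^[l] x = T^[i] x then c l else 0) = c i := by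
    rw [Finset.sum_eq_single i]
    · simp
    · intro l _ hli
      rw [if_neg]
      intro h
      rcases lt_trichotomy (l : ℕ) i with h1 | h1 | h1
      · exact hap _ (Nat.sub_pos_of_lt h1) (hinj _ _ h1.le x hx x hx h.symm)
      · exact hli (Fin.ext h1)
      · exact hap _ (Nat.sub_pos_of_lt h1) (hinj _ _ h1.le x hx x hx h)
    · simp
  rw [hl] at heq
  obtain ⟨l, -, hl⟩ := Finset.exists_ne_zero_of_sum_ne_zero (heq ▸ hi)
  have h1 : T^[l] y = T^[i] x := by
    by_contra h; exact hl (if_neg h)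
  rw [if_pos h1] at hl
  exact ⟨_, hinj _ _ (hmin l hl) x hx y hy h1⟩

lemma comb {E : Type*} [DecidableEq E] {T : E → E} {X : Set E} (hTX : MapsTo T X X)
    (hT : InjOn T X)
    {x y : E} (hx : x ∈ X) (hy : y ∈ X) (hxy : x ≠ y) (hap : ∀ p, 0 < p → T^[p] x ≠ x)
    (hap' : ∀ p, 0 < p → T^[p] y ≠ y)
    {k : ℕ} {c : Fin k → ℝ}
    (heq : ∀ p, (∃ l : Fin k, T^[l] x = p ∨ T^[l] y = p) →
      ∑ l : Fin k, (if T^[l] x = p then c l else 0) =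
      ∑ l : Fin k, (if T^[l] y = p then c l else 0)) : c = 0 := by
  by_contra hc
  obtain ⟨i0, hi0⟩ := Function.ne_iff.1 hc
  obtain ⟨i, hi, hmin⟩ := Finset.exists_min_image (Finset.univ.filter fun i => c i ≠ 0) id
    ⟨i0, by simpa using hi0⟩
  have hi' : c i ≠ 0 := by simpa using hi
  have hmin' : ∀ i', c i' ≠ 0 → i ≤ i' := fun i' h => hmin i' (by simpa using h)
  obtain ⟨a, ha⟩ := comb_half hTX hT hx hy hap hi' hmin' (heq _ ⟨i, Or.inl rfl⟩)
  obtain ⟨b, hb⟩ := comb_half hTX hT hy hx hap' hi' hmin' (heq _ ⟨i, Or.inr rfl⟩).symm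
  rcases Nat.eq_zero_or_pos a with h | h
  · subst h; exact hxy ha.symm
  · refine hap (a + b) (by omega) ?_
    rw [Function.iterate_add_apply, hb, ha]

lemma exists_L (k m : ℕ) : ∃ L : (Fin k → Fin m → ℝ) →L[ℝ] ((Fin m → ℝ) →L[ℝ] (Fin k → ℝ)),
    ∀ M α i, L M α i = ∑ j, M i j * α j := by
  refine ⟨LinearMap.toContinuousLinearMap
    ((LinearMap.toContinuousLinearMap (𝕜 := ℝ) (E := Fin m → ℝ) (F' := Fin k → ℝ)).toLinearMap ∘ₗ
      (Matrix.toLin' (R := ℝ) (m := Fin k) (n := Fin m)).toLinearMap ∘ₗ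
      (Matrix.ofLinearEquiv ℝ).toLinearMap), fun M α i => ?_⟩
  simp [Matrix.mulVec, dotProduct]

lemma surj_of {k m : ℕ} (D : (Fin m → ℝ) →L[ℝ] (Fin k → ℝ))
    (h : ∀ c : Fin k → ℝ, (∀ α, ∑ i, c i * D α i = 0) → c = 0) : Function.Surjective D := by
  by_contra hns
  have hr : LinearMap.range (D : (Fin m → ℝ) →ₗ[ℝ] (Fin k → ℝ)) < ⊤ :=
    lt_top_iff_ne_top.2 fun h => hns (LinearMap.range_eq_top.1 h)
  obtain ⟨f, hf, hle⟩ := Submodule.exists_le_ker_of_lt_top _ hr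
  have hfz : ∀ z : Fin k → ℝ, f z = ∑ i, f (Pi.single i 1) * z i := fun z => by
    conv_lhs => rw [← LinearMap.sum_single_apply (fun _ => ℝ) z, map_sum]
    refine Finset.sum_congr rfl fun i _ => ?_
    have : (LinearMap.single ℝ (fun _ => ℝ) i) (z i) = z i • (Pi.single i (1:ℝ) : Fin k → ℝ) := by
      ext l; simp [Pi.single_apply]
    simp only [LinearMap.single_apply] at this
    rw [this, map_smul, smul_eq_mul, mul_comm]
  have hc := h (fun i => f (Pi.single i 1)) (fun α => by
    rw [← hfz]
    exact hle ⟨α, rfl⟩)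
  apply hf
  ext z
  simp [congrFun hc z]

lemma hyper_null {m : ℕ} (a : ℝ) (d : Fin m → ℝ) (hd : d ≠ 0) :
    volume {α : Fin m → ℝ | a + ∑ j, α j * d j = 0} = 0 := by
  obtain ⟨j0, hj0⟩ := Function.ne_iff.1 hd
  have hmeas : MeasurableSet {α : Fin m → ℝ | a + ∑ j, α j * d j = 0} :=
    (isClosed_eq (by fun_prop) continuous_const).measurableSet
  let S : (Fin 1 → ℝ) →L[ℝ] (Fin m → ℝ) :=
    (ContinuousLinearMap.proj (R := ℝ) (φ := fun _ : Fin 1 => ℝ) 0).smulRight (Pi.single j0 (1:ℝ))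
  refine null_of_slices hmeas S fun b => ?_
  refine Set.Subsingleton.measure_zero ?_ _
  intro t ht t' ht'
  simp only [mem_setOf_eq, S, ContinuousLinearMap.smulRight_apply, ContinuousLinearMap.proj_apply,
    Pi.add_apply, Pi.smul_apply, smul_eq_mul, add_mul, Finset.sum_add_distrib, Pi.single_apply,
    mul_ite, mul_one, mul_zero, ite_mul, zero_mul, Finset.sum_ite_eq', Finset.mem_univ, if_true]
    at ht ht'
  have h1 : t 0 * d j0 = t' 0 * d j0 := by linarith
  have h2 := mul_right_cancel₀ hj0 h1
  ext i
  rw [Subsingleton.elim i 0, h2]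

lemma meas_inter {E F : Type*} [TopologicalSpace E] [MeasurableSpace E] [BorelSpace E]
    [TopologicalSpace F] {X : Set E} (hX : MeasurableSet X) {f : E → F} (hf : ContinuousOn f X)
    {U : Set F} (hU : IsOpen U) : MeasurableSet (X ∩ f ⁻¹' U) := by
  obtain ⟨W, hW, h⟩ := continuousOn_iff'.1 hf U hU
  rw [inter_comm, h]
  exact hW.measurableSet.inter hX

lemma meas_fix {E : Type*} [TopologicalSpace E] [T2Space E] [MeasurableSpace E] [BorelSpace E]
    {X : Set E} (hX : MeasurableSet X) {f : E → E} (hf : ContinuousOn f X) :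
    MeasurableSet {x ∈ X | f x = x} := by
  have h1 : IsClosed {x : X | f x = x} :=
    isClosed_eq (continuousOn_iff_continuous_restrict.1 hf) continuous_subtype_val
  have h2 := hX.subtype_image h1.measurableSet
  convert h2 using 1
  ext x
  simp [and_comm]

/-- Periodic case: the measure is carried by a countable set. -/
lemma periodic_case {E : Type*} [MetricSpace E] [SecondCountableTopology E] [MeasurableSpace E]
    [BorelSpace E] {X : Set E} (hX : MeasurableSet X) (μ : Measure E) {T : E → E}
    (hTX : MapsTo T X X) (hTinj : InjOn T X) (hTc : ContinuousOn T X)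
    (herg : ∀ Y : Set E, MeasurableSet Y → Y ⊆ X →
      X ∩ T ⁻¹' Y = Y → μ Y = 0 ∨ μ (X \ Y) = 0)
    {p : ℕ} (hp : 0 < p) (hPp : μ {x ∈ X | T^[p] x = x} ≠ 0) :
    ∃ O ⊆ X, O.Countable ∧ μ (X \ O) = 0 := by
  have hic : ∀ i, ContinuousOn T^[i] X := fun i => hTc.iterate hTX i
  set P := {x ∈ X | T^[p] x = x} with hPdef
  have hPm : MeasurableSet P := meas_fix hX (hic p)
  have hPinv : ∀ z ∈ X, T z ∈ P ↔ z ∈ P := by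
    intro z hz
    have e : T^[p] (T z) = T (T^[p] z) := by
      rw [← Function.iterate_succ_apply, Function.iterate_succ_apply']
    constructor
    · rintro ⟨-, h⟩
      rw [e] at h
      exact ⟨hz, hTinj (hTX.iterate p hz) hz h⟩
    · rintro ⟨-, h⟩
      refine ⟨hTX hz, ?_⟩
      rw [e, h]
  obtain ⟨x₀, hx₀, hpos⟩ := exists_mem_forall_mem_nhdsWithin_pos_measure hPp
  let A : ℕ → Set E := fun n => {z ∈ P | ∃ i < p, T^[i] z ∈ Metric.ball x₀ (1 / ((n : ℝ) + 1))}
  have hAm : ∀ n, MeasurableSet (A n) := by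
    intro n
    have : A n = ⋃ i ∈ Finset.range p,
        P ∩ (X ∩ T^[i] ⁻¹' Metric.ball x₀ (1 / ((n : ℝ) + 1))) := by
      ext z
      simp only [A, mem_setOf_eq, mem_iUnion, Finset.mem_range, mem_inter_iff, mem_preimage]
      constructor
      · rintro ⟨hz, i, hi, h⟩
        exact ⟨i, hi, hz, hz.1, h⟩
      · rintro ⟨i, hi, hz, -, h⟩
        exact ⟨hz, i, hi, h⟩
    rw [this]
    exact Finset.measurableSet_biUnion _ fun i _ =>
      hPm.inter (meas_inter hX (hic i) Metric.isOpen_ball)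
  have hAX : ∀ n, A n ⊆ X := fun n z hz => hz.1.1
  have hAinv : ∀ n, X ∩ T ⁻¹' (A n) = A n := by
    intro n
    ext z
    constructor
    · rintro ⟨hz, hTz, i, hi, h⟩
      have hzP := (hPinv z hz).1 hTz
      refine ⟨hzP, ?_⟩
      rw [← Function.iterate_succ_apply] at h
      rcases Nat.lt_or_ge (i + 1) p with h1 | h1
      · exact ⟨i + 1, h1, h⟩
      · obtain rfl : p = i + 1 := by omega
        refine ⟨0, hp, ?_⟩
        have := hzP.2
        rw [Nat.succ_eq_add_one, this] at h
        exact h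
    · rintro ⟨hz, i, hi, h⟩
      refine ⟨hz.1, (hPinv z hz.1).2 hz, ?_⟩
      rcases i with _ | i
      · refine ⟨p - 1, by omega, ?_⟩
        rw [← Function.iterate_succ_apply, Nat.succ_eq_add_one, Nat.sub_add_cancel hp, hz.2]
        exact h
      · exact ⟨i, by omega, by rw [← Function.iterate_succ_apply]; exact h⟩
  have hAfull : ∀ n, μ (X \ A n) = 0 := by
    intro n
    refine (herg (A n) (hAm n) (hAX n) (hAinv n)).resolve_left ?_
    refine (hpos _ ?_).ne'
    have hb : Metric.ball x₀ (1 / ((n : ℝ) + 1)) ∈ 𝓝 x₀ :=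
      Metric.ball_mem_nhds _ (by positivity)
    filter_upwards [self_mem_nhdsWithin, mem_nhdsWithin_of_mem_nhds hb] with z hz hzb
    exact ⟨hz, 0, hp, hzb⟩
  refine ⟨⋃ i : ℕ, {z ∈ X | T^[i] z = x₀}, iUnion_subset fun i z hz => hz.1, ?_, ?_⟩
  · refine countable_iUnion fun i => Set.Subsingleton.countable ?_
    intro z hz z' hz'
    exact hTinj.iterate hTX i hz.1 hz'.1 (hz.2.trans hz'.2.symm)
  · refine measure_mono_null (t := ⋃ n, X \ A n) ?_ (measure_iUnion_null hAfull)
    rintro z ⟨hz, hzO⟩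
    by_contra hcon
    have hall : ∀ n, z ∈ A n := fun n => by
      by_contra h
      exact hcon (mem_iUnion.2 ⟨n, hz, h⟩)
    apply hzO
    have hfin : ((fun i => T^[i] z) '' (Set.Iio p)).Finite := (Set.finite_Iio p).image _
    have hcl : x₀ ∈ closure ((fun i => T^[i] z) '' (Set.Iio p)) := by
      rw [Metric.mem_closure_iff]
      intro ε hε
      obtain ⟨n, hn⟩ := exists_nat_one_div_lt hε
      obtain ⟨-, i, hi, h⟩ := hall n
      refine ⟨_, ⟨i, hi, rfl⟩, ?_⟩
      rw [dist_comm]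
      exact (Metric.mem_ball.1 h).trans hn
    rw [hfin.isClosed.closure_eq] at hcl
    obtain ⟨i, -, h⟩ := hcl
    exact mem_iUnion.2 ⟨i, hz, h⟩

end TakensAux

/-- **Probabilistic Takens delay embedding theorem, ergodic case (c):**
if `μ` is `T`-invariant and ergodic, the assumption on periodic points can be omitted. -/
theorem probabilistic_takens_ergodic {N k m : ℕ} {β : ℝ}
    (hβ : β ∈ Set.Ioc (0 : ℝ) 1)
    (X : Set (EuclideanSpace ℝ (Fin N))) (hX : MeasurableSet X)
    (μ : Measure (EuclideanSpace ℝ (Fin N))) [SigmaFinite μ]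
    (hμX : μ Xᶜ = 0)
    (T : EuclideanSpace ℝ (Fin N) → EuclideanSpace ℝ (Fin N))
    (hTX : Set.MapsTo T X X) (hTinj : Set.InjOn T X)
    (hTlip : LocallyHolderOn 1 T X)
    (hXH : μH[β * k] X = 0)
    (hinv : ∀ Y : Set (EuclideanSpace ℝ (Fin N)), MeasurableSet Y → Y ⊆ X →
      μ (X ∩ T ⁻¹' Y) = μ Y)
    (herg : ∀ Y : Set (EuclideanSpace ℝ (Fin N)), MeasurableSet Y → Y ⊆ X →
      X ∩ T ⁻¹' Y = Y → μ Y = 0 ∨ μ (X \ Y) = 0)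
    (h : EuclideanSpace ℝ (Fin N) → ℝ)
    (hh : LocallyHolderOn β h X)
    (hfam : Fin m → EuclideanSpace ℝ (Fin N) → ℝ)
    (hinterp : IsInterpolatingFamily X hfam (2 * k))
    (hfamHolder : ∀ j, LocallyHolderOn β (hfam j) X) :
    ∀ᵐ α ∂(volume : Measure (Fin m → ℝ)),
      ∃ X_α : Set (EuclideanSpace ℝ (Fin N)), X_α ⊆ X ∧ MeasurableSet X_α ∧
        μ (X \ X_α) = 0 ∧
        Set.InjOn (fun x => fun i : Fin k =>
          h (T^[(i : ℕ)] x) + ∑ j, α j * hfam j (T^[(i : ℕ)] x)) X_α := by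
  classical
  have hβ0 := hβ.1
  rcases Nat.eq_zero_or_pos k with hk | hk
  · subst hk
    have hXe : X = ∅ := by
      by_contra hne
      have h1 := Measure.one_le_hausdorffMeasure_zero_of_nonempty
        (Set.nonempty_iff_ne_empty.2 hne)
      simp only [Nat.cast_zero, mul_zero] at hXH
      rw [hXH] at h1
      simp at h1
    subst hXe
    exact Filter.Eventually.of_forall fun α => ⟨∅, subset_rfl, MeasurableSet.empty, by simp, by simp⟩
  have hTc : ContinuousOn T X := TakensAux.lh_cont one_pos hTlip
  by_cases hper : ∃ p, 0 < p ∧ μ {x ∈ X | T^[p] x = x} ≠ 0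
  · obtain ⟨p, hp, hPp⟩ := hper
    obtain ⟨O, hOX, hOc, hO0⟩ := TakensAux.periodic_case hX μ hTX hTinj hTc herg hp hPp
    have hae : ∀ᵐ α ∂(volume : Measure (Fin m → ℝ)), ∀ z ∈ O, ∀ z' ∈ O, z ≠ z' →
        (h z - h z') + ∑ j, α j * (hfam j z - hfam j z') ≠ 0 := by
      rw [ae_ball_iff hOc]
      intro z hz
      rw [ae_ball_iff hOc]
      intro z' hz'
      by_cases hne : z = z'
      · exact Filter.Eventually.of_forall fun α hh => absurd hne hh
      · have hd : (fun j => hfam j z - hfam j z') ≠ 0 := by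
          intro hd
          have := TakensAux.interp_finset hinterp {z, z'}
            (by intro w hw; simp at hw; rcases hw with rfl | rfl; exacts [hOX hz, hOX hz'])
            (by rw [Finset.card_pair hne]; omega)
            (fun w => if w = z then 1 else -1)
            (by
              intro j
              have hj := congrFun hd j
              simp only [Pi.zero_apply] at hj
              rw [Finset.sum_pair hne]
              simp only [if_true, if_neg (Ne.symm hne)]
              linarith) z (by simp)
          simp at this
        have := TakensAux.hyper_null (h z - h z') _ hd
        rw [ae_iff]
        refine measure_mono_null ?_ this
        intro α hα
        simp only [mem_setOf_eq, not_forall, not_not] at hα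
        exact hα.2
    filter_upwards [hae] with α hα
    refine ⟨O, hOX, hOc.measurableSet, hO0, ?_⟩
    intro z hz z' hz' heq
    by_contra hne
    have h0 := congrFun heq ⟨0, hk⟩
    simp only [Function.iterate_zero, id] at h0
    apply hα z hz z' hz' hne
    simp only [mul_sub, Finset.sum_sub_distrib]
    linarith
  · push Not at hper
    set P : Set (EuclideanSpace ℝ (Fin N)) := ⋃ p : ℕ, {x ∈ X | T^[p + 1] x = x} with hP
    have hPm : MeasurableSet P := MeasurableSet.iUnion fun p =>
      TakensAux.meas_fix hX (hTc.iterate hTX _)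
    have hP0 : μ P = 0 := measure_iUnion_null fun p => hper (p + 1) (Nat.succ_pos p)
    have hYX : X \ P ⊆ X := fun x hx => hx.1
    have hap : ∀ x ∈ X \ P, ∀ p, 0 < p → T^[p] x ≠ x := by
      intro x hx p hp he
      refine hx.2 (mem_iUnion.2 ⟨p - 1, hx.1, ?_⟩)
      rwa [Nat.sub_add_cancel hp]
    obtain ⟨L, hL⟩ := TakensAux.exists_L k m
    let M : EuclideanSpace ℝ (Fin N) → Fin k → Fin m → ℝ := fun y i j => hfam j (T^[(i : ℕ)] y)
    have hv : LocallyHolderOn β (fun y => fun i : Fin k => h (T^[(i : ℕ)] y)) X :=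
      TakensAux.lh_pi fun i => TakensAux.lh_iter hβ0 hTlip hTX i hh
    have hM : LocallyHolderOn β M X :=
      TakensAux.lh_pi fun i => TakensAux.lh_pi fun j =>
        TakensAux.lh_iter hβ0 hTlip hTX i (hfamHolder j)
    have main := TakensAux.ae_inj hβ0 (hX.diff hPm) (measure_mono_null hYX hXH) μ
      (fun y => fun i : Fin k => h (T^[(i : ℕ)] y)) (fun y => L (M y))
      (TakensAux.lh_mono hv hYX) (TakensAux.lh_mono (TakensAux.lh_clm hM L) hYX) ?_
    · filter_upwards [main] with α hα
      obtain ⟨Z, hZ, hZm, hZ0, hinj⟩ := hα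
      refine ⟨Z, hZ.trans hYX, hZm, ?_, ?_⟩
      · refine measure_mono_null (t := P ∪ ((X \ P) \ Z)) ?_ (measure_union_null hP0 hZ0)
        intro x hx
        by_cases hxP : x ∈ P
        · exact Or.inl hxP
        · exact Or.inr ⟨⟨hx.1, hxP⟩, hx.2⟩
      · convert hinj using 2 with x
        ext i
        simp only [Pi.add_apply, hL, M]
        congr 1
        exact Finset.sum_congr rfl fun j _ => mul_comm _ _
    · intro x hx y hy hxy
      refine TakensAux.surj_of _ fun c hc => ?_
      refine TakensAux.comb hTX hTinj hx.1 hy.1 hxy (hap x hx) (hap y hy) ?_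
      let Px : Finset (EuclideanSpace ℝ (Fin N)) :=
        Finset.univ.image (fun l : Fin k => T^[(l : ℕ)] x)
      let Py : Finset (EuclideanSpace ℝ (Fin N)) :=
        Finset.univ.image (fun l : Fin k => T^[(l : ℕ)] y)
      have hmx : ∀ l : Fin k, T^[(l : ℕ)] x ∈ Px ∪ Py := fun l =>
        Finset.mem_union_left _ (Finset.mem_image_of_mem _ (Finset.mem_univ l))
      have hmy : ∀ l : Fin k, T^[(l : ℕ)] y ∈ Px ∪ Py := fun l =>
        Finset.mem_union_right _ (Finset.mem_image_of_mem _ (Finset.mem_univ l))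
      have key := TakensAux.interp_finset hinterp (Px ∪ Py)
        (by
          intro w hw
          simp only [Px, Py, Finset.coe_union, Finset.coe_image, Finset.coe_univ, image_univ,
            mem_union, mem_range] at hw
          rcases hw with ⟨l, rfl⟩ | ⟨l, rfl⟩
          exacts [hTX.iterate _ hx.1, hTX.iterate _ hy.1])
        (by
          refine (Finset.card_union_le _ _).trans ?_
          have h1 : Px.card ≤ k := Finset.card_image_le.trans (by simp)
          have h2 : Py.card ≤ k := Finset.card_image_le.trans (by simp)
          omega)
        (fun p => ∑ l : Fin k, (if T^[(l : ℕ)] x = p then c l else 0) -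
          ∑ l : Fin k, (if T^[(l : ℕ)] y = p then c l else 0))
        (by
          intro j
          have hcj := hc (Pi.single j 1)
          simp only [_root_.sub_apply, Pi.sub_apply, hL, M, Pi.single_apply, mul_ite, mul_one,
            mul_zero, Finset.sum_ite_eq', Finset.mem_univ, if_true] at hcj
          simp only [sub_mul, Finset.sum_mul, Finset.sum_sub_distrib]
          rw [Finset.sum_comm, Finset.sum_comm (s := Px ∪ Py)]
          simp only [ite_mul, zero_mul, Finset.sum_ite_eq, hmx, hmy, if_true]
          rw [← hcj, ← Finset.sum_sub_distrib]
          exact Finset.sum_congr rfl fun i _ => by ring)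
      rintro p ⟨l, rfl | rfl⟩
      · exact sub_eq_zero.1 (key _ (hmx l))
      · exact sub_eq_zero.1 (key _ (hmy l))
end

section
/- Let X ⊆ ℝ^N be a Borel set, T : X → X a Borel measurable injective map, and μ a nonzero Borel σ-finite measure on X that is T-invariant (μ(T^{-1}Y) = μ(Y) for all Borel Y ⊆ X) and ergodic (every Borel set Y ⊆ X with T^{-1}Y = Y satisfies μ(Y) = 0 or μ(X ∖ Y) = 0). Let P = {x ∈ X : T^p x = x for some p ≥ 1} be the set of all periodic points of T. Then either μ(P) = 0, or there exist x ∈ X and p ≥ 1 with T^p x = x such that the finite set {x, Tx, …, T^{p−1}x} has full μ-measure. -/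
open MeasureTheory Set
open scoped ENNReal

/-- For an injective Borel map `T : X → X` of a Borel set `X ⊆ ℝ^N` with a nonzero
`σ`-finite `T`-invariant ergodic Borel measure `μ` on `X`, either the set of all periodic
points of `T` has `μ`-measure zero, or a single periodic orbit `{x, Tx, …, T^{p−1}x}` has
full `μ`-measure. -/
theorem ergodic_periodic_points_dichotomy {N : ℕ}
    (X : Set (EuclideanSpace ℝ (Fin N))) (hX : MeasurableSet X)
    (T : EuclideanSpace ℝ (Fin N) → EuclideanSpace ℝ (Fin N))
    (hTmeas : Measurable T) (hTX : Set.MapsTo T X X) (hTinj : Set.InjOn T X)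
    (μ : Measure (EuclideanSpace ℝ (Fin N))) [SigmaFinite μ]
    (hμX : μ Xᶜ = 0) (hμ0 : μ X ≠ 0)
    (hinv : ∀ Y : Set (EuclideanSpace ℝ (Fin N)), MeasurableSet Y → Y ⊆ X →
      μ (X ∩ T ⁻¹' Y) = μ Y)
    (herg : ∀ Y : Set (EuclideanSpace ℝ (Fin N)), MeasurableSet Y → Y ⊆ X →
      X ∩ T ⁻¹' Y = Y → μ Y = 0 ∨ μ (X \ Y) = 0) :
    μ {x ∈ X | ∃ p : ℕ, 1 ≤ p ∧ T^[p] x = x} = 0 ∨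
    ∃ x ∈ X, ∃ p : ℕ, 1 ≤ p ∧ T^[p] x = x ∧
      μ (X \ {y | ∃ i : ℕ, i < p ∧ T^[i] x = y}) = 0 := by
  by_cases hP : μ {x ∈ X | ∃ p : ℕ, 1 ≤ p ∧ T^[p] x = x} = 0
  · exact Or.inl hP
  right
  have hex : ∃ p : ℕ, 1 ≤ p ∧ μ {x ∈ X | T^[p] x = x} ≠ 0 := by
    by_contra! hcon
    apply hP
    have hsub : {x ∈ X | ∃ p : ℕ, 1 ≤ p ∧ T^[p] x = x} ⊆
        ⋃ p : ℕ, {x ∈ X | T^[p + 1] x = x} := by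
      rintro x ⟨hx, p, hp, hpx⟩
      obtain ⟨q, rfl⟩ : ∃ q, p = q + 1 := ⟨p - 1, by omega⟩
      exact mem_iUnion.2 ⟨q, hx, hpx⟩
    exact measure_mono_null hsub (measure_iUnion_null fun p => hcon (p + 1) (by omega))
  obtain ⟨p, hp, hpos⟩ := hex
  set E : Set (EuclideanSpace ℝ (Fin N)) := {x ∈ X | T^[p] x = x} with hE
  have hEm : MeasurableSet E := by
    have h1 : MeasurableSet {x | T^[p] x = x} :=
      measurableSet_eq_fun (hTmeas.iterate p) measurable_id
    exact hX.inter h1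
  have hET : ∀ x ∈ E, T x ∈ E := by
    rintro x ⟨hx, hpx⟩
    refine ⟨hTX hx, ?_⟩
    rw [← Function.iterate_succ_apply, Function.iterate_succ_apply', hpx]
  have hitX : ∀ n : ℕ, ∀ x ∈ X, T^[n] x ∈ X := fun n x hx => hTX.iterate n hx
  have hTE : ∀ x ∈ X, T x ∈ E → x ∈ E := by
    rintro x hx ⟨_, h2⟩
    refine ⟨hx, hTinj (hitX p x hx) hx ?_⟩
    rw [← Function.iterate_succ_apply' T p x, Function.iterate_succ_apply, h2]
  have hEfull : μ (X \ E) = 0 := by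
    refine (herg E hEm (fun x hx => hx.1) ?_).resolve_left hpos
    ext x
    exact ⟨fun h => hTE x h.1 h.2, fun h => ⟨h.1, hET x h⟩⟩
  let S : Set (EuclideanSpace ℝ (Fin N)) → Set (EuclideanSpace ℝ (Fin N)) :=
    fun A => {x ∈ E | ∃ i : ℕ, T^[i] x ∈ A}
  have hSm : ∀ A, MeasurableSet A → MeasurableSet (S A) := by
    intro A hA
    have h1 : S A = E ∩ ⋃ i : ℕ, T^[i] ⁻¹' A := by
      ext x; simp [S]
    rw [h1]
    exact hEm.inter (MeasurableSet.iUnion fun i => hTmeas.iterate i hA)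
  have hS : ∀ A, MeasurableSet A → μ (S A) = 0 ∨ μ (X \ S A) = 0 := by
    intro A hA
    refine herg _ (hSm A hA) (fun x hx => hx.1.1) ?_
    ext x
    constructor
    · rintro ⟨hx, h1, i, hi⟩
      exact ⟨hTE x hx h1, i + 1, hi⟩
    · rintro ⟨hx, i, hi⟩
      refine ⟨hx.1, hET x hx, i + (p - 1), ?_⟩
      rw [← Function.iterate_succ_apply]
      have h2 : (i + (p - 1)).succ = i + p := by omega
      rw [h2, Function.iterate_add_apply, hx.2]
      exact hi
  let B := TopologicalSpace.countableBasis (EuclideanSpace ℝ (Fin N))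
  have hBc : B.Countable := TopologicalSpace.countable_countableBasis _
  have hBb : TopologicalSpace.IsTopologicalBasis B :=
    TopologicalSpace.isBasis_countableBasis _
  let Z : Set (EuclideanSpace ℝ (Fin N)) :=
    {x ∈ E | ∀ U ∈ B, (μ (S U) = 0 → x ∉ S U) ∧ (μ (X \ S U) = 0 → x ∈ S U)}
  have hZ : μ (X \ Z) = 0 := by
    have hsub : X \ Z ⊆ (X \ E) ∪ ⋃ U ∈ B,
        ({x | μ (S U) = 0 ∧ x ∈ S U} ∪ {x | μ (X \ S U) = 0 ∧ x ∈ X \ S U}) := by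
      rintro x ⟨hx, hxZ⟩
      by_contra hc
      simp only [mem_union, mem_iUnion, not_or, not_exists] at hc
      apply hxZ
      refine ⟨by_contra fun h => hc.1 ⟨hx, h⟩, fun U hU => ⟨fun h1 h2 => ?_, fun h1 => ?_⟩⟩
      · exact (hc.2 U hU).1 ⟨h1, h2⟩
      · by_contra h2
        exact (hc.2 U hU).2 ⟨h1, hx, h2⟩
    refine measure_mono_null hsub (measure_union_null hEfull ?_)
    refine (measure_biUnion_null_iff hBc).2 fun U _ => measure_union_null ?_ ?_
    · by_cases h : μ (S U) = 0
      · exact measure_mono_null (fun x hx => hx.2) h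
      · simp [h]
    · by_cases h : μ (X \ S U) = 0
      · exact measure_mono_null (fun x hx => hx.2) h
      · simp [h]
  have hne : Z.Nonempty := by
    rw [nonempty_iff_ne_empty]
    intro h
    rw [h, diff_empty] at hZ
    exact hμ0 hZ
  obtain ⟨x, hxE, hxB⟩ := hne
  refine ⟨x, hxE.1, p, hp, hxE.2, measure_mono_null ?_ hZ⟩
  refine diff_subset_diff_right ?_
  rintro y ⟨hyE, hyB⟩
  by_contra hy
  have hfin : ({y | ∃ i : ℕ, i < p ∧ T^[i] x = y}).Finite :=
    (Set.finite_Iio p).image (fun i => T^[i] x)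
  obtain ⟨U, hU, hyU, hUs⟩ := hBb.exists_subset_of_mem_open
    (show y ∈ {y | ∃ i : ℕ, i < p ∧ T^[i] x = y}ᶜ from hy) hfin.isClosed.isOpen_compl
  have hyS : y ∈ S U := ⟨hyE, 0, hyU⟩
  have hfull : μ (X \ S U) = 0 :=
    (hS U (hBb.isOpen hU).measurableSet).resolve_left fun h => (hyB U hU).1 h hyS
  obtain ⟨_, i, hi⟩ := (hxB U hU).2 hfull
  refine hUs hi ⟨i % p, Nat.mod_lt _ hp, ?_⟩
  exact Function.IsPeriodicPt.iterate_mod_apply (show Function.IsPeriodicPt T p x from hxE.2) i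
end

section
/- There exists an absolute constant C > 0 (independent of all other data) such that for all N, k ∈ ℕ with N, k ≥ 1, every x ∈ ℝ^N with x ≠ 0, every z ∈ ℝ^k and every ε > 0, the following holds: if (l_1,…,l_k) is chosen according to the probability measure η_{N,k}, the k-fold product of the normalized Lebesgue measure on the open unit ball B_N(0,1) ⊆ ℝ^N, then η_{N,k}({(l_1,…,l_k) ∈ B_N(0,1)^k : ‖(⟨l_1,x⟩ + z_1, …, ⟨l_k,x⟩ + z_k)‖ ≤ ε}) ≤ C · N^{k/2} · ε^k / ‖x‖^k. -/
open MeasureTheory Set Metric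
open scoped InnerProductSpace ENNReal

lemma slab (M : ℕ) (x : EuclideanSpace ℝ (Fin (M+1))) (hx : x ≠ 0) (S : Set ℝ) (hS : MeasurableSet S) :
    volume ({l : EuclideanSpace ℝ (Fin (M+1)) | ⟪l, x⟫_ℝ ∈ S} ∩ ball 0 1) ≤
      ENNReal.ofReal (‖x‖⁻¹) * volume S * volume (ball (0 : EuclideanSpace ℝ (Fin M)) 1) := by
  have hx' : ‖x‖ ≠ 0 := norm_ne_zero_iff.2 hx
  obtain ⟨b, hb⟩ := Orthonormal.exists_orthonormalBasis_extension_of_card_eq (𝕜 := ℝ)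
    (E := EuclideanSpace ℝ (Fin (M+1))) (ι := Fin (M+1)) (by simp)
    (v := fun _ => (‖x‖⁻¹ : ℝ) • x) (s := {0}) (by
      rw [orthonormal_iff_ite]
      rintro ⟨i, hi⟩ ⟨j, hj⟩
      simp only [mem_singleton_iff] at hi hj
      subst hi; subst hj
      simp [Set.domRestrict, norm_smul, hx'])
  have hb0 : b 0 = (‖x‖⁻¹ : ℝ) • x := hb 0 rfl
  have hxb : x = ‖x‖ • b 0 := by rw [hb0, smul_smul, mul_inv_cancel₀ hx', one_smul]
  let g : EuclideanSpace ℝ (Fin (M+1)) → ℝ × (Fin M → ℝ) :=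
    fun l => (MeasurableEquiv.piFinSuccAbove (fun _ : Fin (M+1) => ℝ) 0) (WithLp.ofLp (b.repr l))
  have hg : MeasurePreserving g volume volume :=
    ((volume_preserving_piFinSuccAbove (fun _ : Fin (M+1) => ℝ) 0).comp
      (PiLp.volume_preserving_ofLp _)).comp b.measurePreserving_repr
  let h : (Fin M → ℝ) → EuclideanSpace ℝ (Fin M) := WithLp.toLp 2
  have hh : MeasurePreserving h volume volume := PiLp.volume_preserving_toLp _
  have hsub : ({l : EuclideanSpace ℝ (Fin (M+1)) | ⟪l, x⟫_ℝ ∈ S} ∩ ball 0 1) ⊆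
      g ⁻¹' (((‖x‖ * ·) ⁻¹' S) ×ˢ (h ⁻¹' ball 0 1)) := by
    rintro l ⟨hl, hl1⟩
    refine ⟨?_, ?_⟩
    · have : ‖x‖ * (g l).1 = ⟪l, x⟫_ℝ := by
        conv_rhs => rw [hxb]
        rw [inner_smul_right, real_inner_comm]
        simp [g, b.repr_apply_apply, Fin.insertNthEquiv]
      show ‖x‖ * (g l).1 ∈ S
      rw [this]; exact hl
    · show h (g l).2 ∈ ball 0 1
      rw [mem_ball_zero_iff] at hl1 ⊢
      refine lt_of_le_of_lt ?_ hl1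
      rw [← b.repr.norm_map l, EuclideanSpace.norm_eq, EuclideanSpace.norm_eq]
      apply Real.sqrt_le_sqrt
      rw [Fin.sum_univ_succ]
      have : ∀ i, h (g l).2 i = b.repr l i.succ := fun i => by
        simp [g, h, Fin.insertNthEquiv, Fin.tail]
      simp only [this]
      have := sq_nonneg ‖b.repr l 0‖
      linarith
  have hm1 : MeasurableSet ((‖x‖ * ·) ⁻¹' S) := (measurable_const_mul _) hS
  have hm2 : MeasurableSet (h ⁻¹' ball 0 1) := hh.measurable measurableSet_ball
  refine (measure_mono hsub).trans ?_
  rw [hg.measure_preimage (hm1.prod hm2).nullMeasurableSet, Measure.volume_eq_prod,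
    Measure.prod_prod, hh.measure_preimage measurableSet_ball.nullMeasurableSet,
    Real.volume_preimage_mul_left hx', abs_of_nonneg (by positivity)]

lemma omega_le (k : ℕ) : volume (ball (0 : EuclideanSpace ℝ (Fin k)) 1) ≤
    ENNReal.ofReal (Real.exp Real.pi) := by
  have hpi := Real.pi_pos
  have h1 : ∫ v : EuclideanSpace ℝ (Fin k), Real.exp (-Real.pi * ‖v‖^2) = 1 := by
    rw [GaussianFourier.integral_rexp_neg_mul_sq_norm hpi, div_self hpi.ne', Real.one_rpow]
  have hi : Integrable (fun v : EuclideanSpace ℝ (Fin k) => Real.exp (-Real.pi * ‖v‖^2)) := by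
    by_contra h
    rw [integral_undef h] at h1
    norm_num at h1
  have h2 : ENNReal.ofReal (Real.exp (-Real.pi)) * volume (ball (0 : EuclideanSpace ℝ (Fin k)) 1) ≤ 1 := by
    rw [← ENNReal.ofReal_one, ← h1, ofReal_integral_eq_lintegral_ofReal hi
      (Filter.Eventually.of_forall fun _ => (Real.exp_pos _).le), ← setLIntegral_const]
    refine (setLIntegral_mono' measurableSet_ball ?_).trans (setLIntegral_le_lintegral _ _)
    intro v hv
    rw [mem_ball_zero_iff] at hv
    apply ENNReal.ofReal_le_ofReal
    apply Real.exp_le_exp.2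
    have : ‖v‖^2 ≤ 1 := by nlinarith [norm_nonneg v]
    nlinarith
  calc volume (ball (0 : EuclideanSpace ℝ (Fin k)) 1)
      = ENNReal.ofReal (Real.exp Real.pi) * (ENNReal.ofReal (Real.exp (-Real.pi)) * volume (ball (0 : EuclideanSpace ℝ (Fin k)) 1)) := by
        rw [← mul_assoc, ← ENNReal.ofReal_mul (Real.exp_pos _).le, ← Real.exp_add]; simp
    _ ≤ _ := by simpa using mul_le_mul_right h2 (ENNReal.ofReal (Real.exp Real.pi))

lemma omega_eq (n : ℕ) : volume (ball (0 : EuclideanSpace ℝ (Fin n)) 1) =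
    ENNReal.ofReal (√Real.pi ^ n / Real.Gamma (n / 2 + 1)) := by
  rcases n with _ | n
  · have h : (ball (0 : EuclideanSpace ℝ (Fin 0)) 1) = WithLp.ofLp ⁻¹' (univ : Set (Fin 0 → ℝ)) := by
      ext v
      simp [Subsingleton.elim v 0]
    rw [h, (PiLp.volume_preserving_ofLp (Fin 0)).measure_preimage nullMeasurableSet_univ]
    simp [volume_pi, Measure.pi_univ]
  · rw [EuclideanSpace.volume_ball]
    simp

lemma omega_ratio (M : ℕ) : volume (ball (0 : EuclideanSpace ℝ (Fin M)) 1) ≤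
    ENNReal.ofReal (√((M+1 : ℕ) : ℝ)) * volume (ball (0 : EuclideanSpace ℝ (Fin (M+1))) 1) := by
  rw [omega_eq, omega_eq, ← ENNReal.ofReal_mul (by positivity)]
  apply ENNReal.ofReal_le_ofReal
  set s : ℝ := M / 2 + 1 with hs
  have hM : (0:ℝ) ≤ M := by positivity
  have hs0 : 0 < s := by positivity
  have e : (((M + 1 : ℕ) : ℝ) / 2 + 1) = 1/2 * s + 1/2 * (s+1) := by
    rw [hs]; push_cast; ring
  have hG := Real.Gamma_pos_of_pos hs0
  have h1 := Real.Gamma_mul_add_mul_le_rpow_Gamma_mul_rpow_Gamma (s := s) (t := s + 1)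
    (a := 1/2) (b := 1/2) hs0 (by positivity) (by norm_num) (by norm_num) (by norm_num)
  rw [← e, Real.Gamma_add_one hs0.ne', ← Real.sqrt_eq_rpow, ← Real.sqrt_eq_rpow,
    Real.sqrt_mul hs0.le, mul_left_comm, Real.mul_self_sqrt hG.le] at h1
  have hG' : 0 < Real.Gamma (((M + 1 : ℕ) : ℝ) / 2 + 1) := Real.Gamma_pos_of_pos (by positivity)
  have h2 : √s ≤ √((M+1 : ℕ) : ℝ) := Real.sqrt_le_sqrt (by rw [hs]; push_cast; linarith)
  have h3 : 1 ≤ √Real.pi := Real.one_le_sqrt.2 (by linarith [Real.pi_gt_three])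
  have h4 : Real.Gamma (((M + 1 : ℕ) : ℝ) / 2 + 1) ≤ √((M+1 : ℕ) : ℝ) * √Real.pi * Real.Gamma s := by
    refine h1.trans (mul_le_mul_of_nonneg_right ?_ hG.le)
    nlinarith [Real.sqrt_nonneg ((M+1 : ℕ) : ℝ)]
  rw [← mul_div_assoc, div_le_div_iff₀ hG hG']
  calc _ ≤ √Real.pi ^ M * (√((M+1 : ℕ) : ℝ) * √Real.pi * Real.Gamma s) := by gcongr
    _ = _ := by ring

lemma pi_le (k : ℕ) (μ : Measure ℝ) (c : ℝ≥0∞) (hc : c ≠ ∞)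
    (h : ∀ S, MeasurableSet S → μ S ≤ c * volume S) (S : Set (Fin k → ℝ)) (hS : MeasurableSet S) :
    Measure.pi (fun _ : Fin k => μ) S ≤ c ^ k * volume S := by
  lift c to NNReal using hc
  have hle : μ ≤ c • volume := Measure.le_iff.2 fun s hs => by simpa using h s hs
  have e : Measure.pi (fun _ : Fin k => c • (volume : Measure ℝ)) = (c ^ k) • volume := by
    refine Measure.pi_eq fun s hs => ?_
    simp only [Measure.smul_apply, ENNReal.smul_def, smul_eq_mul, Finset.prod_mul_distrib,
      volume_pi_pi, Finset.prod_const, Finset.card_univ, Fintype.card_fin, ENNReal.coe_pow]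
  have : Measure.pi (fun _ : Fin k => μ) ≤ Measure.pi (fun _ : Fin k => c • (volume : Measure ℝ)) := by
    refine Measure.le_iff.2 fun s hs => ?_
    rw [Measure.pi, Measure.pi, toMeasure_apply _ _ hs, toMeasure_apply _ _ hs]
    refine (OuterMeasure.le_pi.2 fun t ht => ?_) s
    refine (OuterMeasure.pi_pi_le _ _).trans ?_
    exact Finset.prod_le_prod' fun i _ => hle (t i)
  rw [e] at this
  simpa [ENNReal.smul_def] using this S

theorem key_geometric_inequality :
    ∃ C : ℝ, 0 < C ∧ ∀ (N k : ℕ), 1 ≤ N → 1 ≤ k →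
      ∀ x : EuclideanSpace ℝ (Fin N), x ≠ 0 →
      ∀ z : EuclideanSpace ℝ (Fin k), ∀ ε : ℝ, 0 < ε →
        (Measure.pi fun _ : Fin k =>
            (volume (Metric.ball (0 : EuclideanSpace ℝ (Fin N)) 1))⁻¹ •
              volume.restrict (Metric.ball (0 : EuclideanSpace ℝ (Fin N)) 1))
          {l : Fin k → EuclideanSpace ℝ (Fin N) |
            ‖(EuclideanSpace.equiv (Fin k) ℝ).symm (fun i => ⟪l i, x⟫_ℝ + z i)‖ ≤ ε}
        ≤ ENNReal.ofReal (C * (N : ℝ) ^ ((k : ℝ) / 2) * ε ^ k / ‖x‖ ^ k) := by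
  refine ⟨Real.exp Real.pi, Real.exp_pos _, ?_⟩
  intro N k hN hk x hx z ε hε
  obtain ⟨M, rfl⟩ : ∃ M, N = M + 1 := ⟨N - 1, by omega⟩
  have hx' : 0 < ‖x‖ := norm_pos_iff.2 hx
  set V := volume (Metric.ball (0 : EuclideanSpace ℝ (Fin (M+1))) 1) with hV
  have hV0 : V ≠ 0 := (measure_ball_pos _ _ one_pos).ne'
  have hVt : V ≠ ∞ := measure_ball_lt_top.ne
  set ν : Measure (EuclideanSpace ℝ (Fin (M+1))) := V⁻¹ • volume.restrict (Metric.ball 0 1) with hν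
  have hfin : IsFiniteMeasure ν := ⟨by
    simp only [hν, Measure.smul_apply, Measure.restrict_apply_univ, smul_eq_mul]
    rw [← hV, ENNReal.inv_mul_cancel hV0 hVt]
    exact ENNReal.one_lt_top⟩
  let f : EuclideanSpace ℝ (Fin (M+1)) → ℝ := fun l => ⟪l, x⟫_ℝ
  have hf : Measurable f := by fun_prop
  let T : Set (Fin k → ℝ) := WithLp.toLp 2 ⁻¹' (closedBall (-z) ε)
  have hTp := PiLp.volume_preserving_toLp (Fin k)
  have hT : MeasurableSet T := hTp.measurable measurableSet_closedBall
  have hset : {l : Fin k → EuclideanSpace ℝ (Fin (M+1)) |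
      ‖(EuclideanSpace.equiv (Fin k) ℝ).symm (fun i => ⟪l i, x⟫_ℝ + z i)‖ ≤ ε} =
      (fun (l : Fin k → EuclideanSpace ℝ (Fin (M+1))) i => f (l i)) ⁻¹' T := by
    ext l
    simp only [mem_setOf_eq, mem_preimage, T, mem_closedBall, dist_eq_norm, sub_neg_eq_add]
    rfl
  have hmeas : Measurable (fun (l : Fin k → EuclideanSpace ℝ (Fin (M+1))) i => f (l i)) := by
    fun_prop
  rw [hset, ← Measure.map_apply hmeas hT, Measure.pi_map_pi fun _ => hf.aemeasurable]
  have key : ∀ S, MeasurableSet S →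
      ν.map f S ≤ ENNReal.ofReal (√((M+1 : ℕ) : ℝ) / ‖x‖) * volume S := by
    intro S hS
    rw [Measure.map_apply hf hS, hν, Measure.smul_apply, Measure.restrict_apply (hf hS), smul_eq_mul]
    calc _ ≤ V⁻¹ * (ENNReal.ofReal (‖x‖⁻¹) * volume S * (ENNReal.ofReal (√((M+1 : ℕ) : ℝ)) * V)) := by
          gcongr
          exact (slab M x hx S hS).trans (by gcongr; exact omega_ratio M)
      _ = (V⁻¹ * V) * (ENNReal.ofReal (√((M+1 : ℕ) : ℝ)) * ENNReal.ofReal (‖x‖⁻¹)) * volume S := by ring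
      _ = _ := by
          rw [ENNReal.inv_mul_cancel hV0 hVt, one_mul, ← ENNReal.ofReal_mul (by positivity),
            div_eq_mul_inv]
  refine (pi_le k _ _ ENNReal.ofReal_ne_top key T hT).trans ?_
  rw [hTp.measure_preimage measurableSet_closedBall.nullMeasurableSet,
    Measure.addHaar_closedBall _ _ hε.le]
  simp only [finrank_euclideanSpace, Fintype.card_fin]
  calc _ ≤ ENNReal.ofReal (√((M+1 : ℕ) : ℝ) / ‖x‖) ^ k *
        (ENNReal.ofReal (ε ^ k) * ENNReal.ofReal (Real.exp Real.pi)) := by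
        gcongr
        exact omega_le k
    _ = _ := by
        rw [← ENNReal.ofReal_pow (by positivity), ← ENNReal.ofReal_mul (by positivity),
          ← ENNReal.ofReal_mul (by positivity)]
        congr 1
        rw [div_pow, Real.sqrt_eq_rpow, ← Real.rpow_natCast (_ ^ _) k, ← Real.rpow_mul (by positivity)]
        rw [show (1 / 2 : ℝ) * k = k / 2 by ring]
        ring
end

section
/- Let 𝒳 and 𝒵 be σ-compact metric spaces, let F : 𝒳 × 𝒵 → ℝ^k (k ∈ ℕ) be continuous, and let K ⊆ 𝒳 be σ-compact. Then the set {(x, z) ∈ 𝒳 × 𝒵 : there exists y ∈ K with y ≠ x and F(x,z) = F(y,z)} is σ-compact (in particular, Borel). -/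
open Set

/-- **Lemma 2.4(c).** If `𝒳, 𝒵` are σ-compact metric spaces, `F : 𝒳 × 𝒵 → ℝ^k` is
continuous and `K ⊆ 𝒳` is σ-compact, then
`{(x, z) : F(x,z) = F(y,z) for some y ∈ K \ {x}}` is σ-compact (hence Borel). -/
theorem sigmaCompact_coincidence_set {𝒳 𝒵 : Type*} [MetricSpace 𝒳] [MetricSpace 𝒵]
    [SigmaCompactSpace 𝒳] [SigmaCompactSpace 𝒵] {k : ℕ}
    (F : 𝒳 × 𝒵 → EuclideanSpace ℝ (Fin k)) (hF : Continuous F)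
    (K : Set 𝒳) (hK : IsSigmaCompact K) :
    IsSigmaCompact {p : 𝒳 × 𝒵 | ∃ y ∈ K, y ≠ p.1 ∧ F (y, p.2) = F p} := by
  obtain ⟨C, hC, rfl⟩ := hK
  have key : {p : 𝒳 × 𝒵 | ∃ y ∈ ⋃ n, C n, y ≠ p.1 ∧ F (y, p.2) = F p} =
      ⋃ i : ℕ × ℕ × ℕ, (Prod.snd : 𝒳 × (𝒳 × 𝒵) → 𝒳 × 𝒵) ''
        ((C i.1 ×ˢ compactCovering (𝒳 × 𝒵) i.2.1) ∩
          ({q | 1 / ((i.2.2 : ℝ) + 1) ≤ dist q.1 q.2.1} ∩ {q | F (q.1, q.2.2) = F q.2})) := by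
    ext p
    simp only [mem_setOf_eq, mem_iUnion, mem_image]
    constructor
    · rintro ⟨y, ⟨n, hn⟩, hne, hy⟩
      obtain ⟨m, hm⟩ := exists_mem_compactCovering p
      obtain ⟨j, hj⟩ := exists_nat_one_div_lt (dist_pos.2 hne)
      exact ⟨(n, m, j), (y, p), ⟨⟨hn, hm⟩, hj.le, hy⟩, rfl⟩
    · rintro ⟨i, ⟨y, p'⟩, ⟨⟨hn, -⟩, hj, hy⟩, rfl⟩
      refine ⟨y, ⟨i.1, hn⟩, ?_, hy⟩
      have h1 : (0 : ℝ) < 1 / ((i.2.2 : ℝ) + 1) := by positivity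
      exact dist_pos.1 (h1.trans_le hj)
  rw [key]
  refine isSigmaCompact_iUnion_of_isCompact _ fun i => ?_
  refine IsCompact.image ?_ continuous_snd
  refine ((hC _).prod (isCompact_compactCovering _ _)).inter_right (IsClosed.inter ?_ ?_)
  · exact isClosed_le (by fun_prop) (by fun_prop)
  · exact isClosed_eq (by fun_prop) (by fun_prop)
end

section
/- For t ∈ [0,2) and j ≥ 1 let d_j(t) = ⌊2^j t⌋ − 2⌊2^{j−1} t⌋ ∈ {0,1} denote the j-th digit of the eventually terminating binary expansion of t. Let x, y ∈ [0,1] with x + y < 2, and let M, N ∈ ℕ with 1 ≤ M < N − 1. If the sequence (d_M(x), d_{M+1}(x), …, d_N(x)) is constant and the sequence (d_M(y), d_{M+1}(y), …, d_N(y)) is constant, then the sequence (d_M(x+y), d_{M+1}(x+y), …, d_{N−1}(x+y)) is constant. -/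
open Set

/-- The `j`-th digit (`j ≥ 1`) of the eventually terminating binary expansion of `t ∈ [0,2)`:
`d_j(t) = ⌊2^j t⌋ − 2⌊2^{j−1} t⌋`. -/
noncomputable def binaryDigit (j : ℕ) (t : ℝ) : ℤ :=
  Int.floor ((2 : ℝ) ^ j * t) - 2 * Int.floor ((2 : ℝ) ^ (j - 1) * t)

lemma digit_bounds_aux (j : ℕ) (t : ℝ) :
    0 ≤ ⌊(2:ℝ) ^ (j+1) * t⌋ - 2 * ⌊(2:ℝ) ^ j * t⌋ ∧
      ⌊(2:ℝ) ^ (j+1) * t⌋ - 2 * ⌊(2:ℝ) ^ j * t⌋ ≤ 1 := by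
  have e : (2:ℝ) ^ (j+1) * t = 2 * ((2:ℝ) ^ j * t) := by ring
  rw [e]
  generalize (2:ℝ) ^ j * t = u
  have h1 := Int.floor_le u
  have h2 := Int.lt_floor_add_one u
  have h3 : 2 * ⌊u⌋ ≤ ⌊2 * u⌋ := Int.le_floor.2 (by push_cast; linarith)
  have h4 : ⌊2 * u⌋ < 2 * ⌊u⌋ + 2 := Int.floor_lt.2 (by push_cast; linarith)
  omega

lemma carry_bounds_aux (j : ℕ) (x y : ℝ) :
    ⌊(2:ℝ) ^ j * x⌋ + ⌊(2:ℝ) ^ j * y⌋ ≤ ⌊(2:ℝ) ^ j * (x + y)⌋ ∧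
      ⌊(2:ℝ) ^ j * (x + y)⌋ ≤ ⌊(2:ℝ) ^ j * x⌋ + ⌊(2:ℝ) ^ j * y⌋ + 1 := by
  rw [mul_add]
  generalize (2:ℝ) ^ j * x = u
  generalize (2:ℝ) ^ j * y = v
  have h1 := Int.le_floor_add u v
  have h2 := Int.lt_floor_add_one u
  have h3 := Int.lt_floor_add_one v
  have h4 : ⌊u + v⌋ < ⌊u⌋ + ⌊v⌋ + 2 := Int.floor_lt.2 (by push_cast; linarith)
  omega

/-- **Lemma 5.3.** If `x, y ∈ [0,1]`, `x + y < 2`, `1 ≤ M < N − 1`, and the binary digit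
sequences `(d_M(x),…,d_N(x))` and `(d_M(y),…,d_N(y))` are constant, then the sequence
`(d_M(x+y),…,d_{N−1}(x+y))` is constant. -/
theorem binary_digits_sum_constant (x y : ℝ)
    (hx : x ∈ Set.Icc (0 : ℝ) 1) (hy : y ∈ Set.Icc (0 : ℝ) 1) (hxy : x + y < 2)
    (M N : ℕ) (hM : 1 ≤ M) (hMN : M + 1 < N)
    (hcx : ∀ i, M ≤ i → i ≤ N → binaryDigit i x = binaryDigit M x)
    (hcy : ∀ i, M ≤ i → i ≤ N → binaryDigit i y = binaryDigit M y) :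
    ∀ i, M ≤ i → i ≤ N - 1 → binaryDigit i (x + y) = binaryDigit M (x + y) := by
  intro i hi
  induction i, hi using Nat.le_induction with
  | base => intro _; rfl
  | succ i hi ih =>
    intro hiN
    rw [← ih (by omega)]
    have ax := hcx i hi (by omega)
    have bx := (hcx (i+1) (by omega) (by omega)).trans ax.symm
    have cx := (hcx (i+2) (by omega) (by omega)).trans ax.symm
    have ay := hcy i hi (by omega)
    have bY := (hcy (i+1) (by omega) (by omega)).trans ay.symm
    have cy := (hcy (i+2) (by omega) (by omega)).trans ay.symm
    clear ax ay ih hcx hcy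
    obtain ⟨k, rfl⟩ : ∃ k, i = k + 1 := ⟨i - 1, by omega⟩
    simp only [binaryDigit, show k + 1 + 2 - 1 = k + 2 by omega,
      show k + 1 + 1 - 1 = k + 1 by omega, show k + 1 - 1 = k by omega,
      show k + 1 + 2 = k + 3 by omega, show k + 1 + 1 = k + 2 by omega] at *
    have x0 := digit_bounds_aux k x
    have y0 := digit_bounds_aux k y
    have z0 := digit_bounds_aux k (x + y)
    have z1 := digit_bounds_aux (k+1) (x + y)
    have z2 := digit_bounds_aux (k+2) (x + y)
    have c0 := carry_bounds_aux k x y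
    have c1 := carry_bounds_aux (k+1) x y
    have c2 := carry_bounds_aux (k+2) x y
    have c3 := carry_bounds_aux (k+3) x y
    simp only [show k + 2 + 1 = k + 3 by omega, show k + 1 + 1 = k + 2 by omega] at *
    generalize ⌊(2:ℝ) ^ (k+1) * x⌋ = x1 at *
    generalize ⌊(2:ℝ) ^ (k+1) * y⌋ = y1 at *
    generalize ⌊(2:ℝ) ^ (k+1) * (x+y)⌋ = s1 at *
    generalize ⌊(2:ℝ) ^ k * x⌋ = u0 at *
    generalize ⌊(2:ℝ) ^ k * y⌋ = v0 at *
    generalize ⌊(2:ℝ) ^ k * (x+y)⌋ = s0 at *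
    have hxx : x1 = 2 * u0 ∨ x1 = 2 * u0 + 1 := by omega
    have hyy : y1 = 2 * v0 ∨ y1 = 2 * v0 + 1 := by omega
    have hc0 : s0 = u0 + v0 ∨ s0 = u0 + v0 + 1 := by omega
    have hc1 : s1 = x1 + y1 ∨ s1 = x1 + y1 + 1 := by omega
    rcases hxx with h1 | h1 <;> rcases hyy with h2 | h2 <;> rcases hc0 with h3 | h3 <;>
      rcases hc1 with h4 | h4 <;> omega
end

section
/- Let S¹ = {x ∈ ℝ² : ‖x‖ = 1} be the unit circle and let μ be the normalized arc-length (one-dimensional Hausdorff) probability measure on S¹. Then for every Lipschitz function φ : S¹ → ℝ and every Borel set A ⊆ S¹ with μ(A) = 1, the function φ is not injective on A. -/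
open MeasureTheory Set
open scoped ENNReal

noncomputable def circG (t : ℝ) : EuclideanSpace ℝ (Fin 2) := !₂[Real.cos t, Real.sin t]

lemma circG_lip : LipschitzWith 1 circG := by
  apply LipschitzWith.of_dist_le_mul
  intro a b
  rw [EuclideanSpace.dist_eq]
  simp only [circG, Fin.sum_univ_two, Real.dist_eq, sq_abs, NNReal.coe_one, one_mul]
  apply Real.sqrt_le_iff.2 ⟨abs_nonneg _, ?_⟩
  have h := Real.one_sub_sq_div_two_le_cos (x := a - b)
  rw [Real.cos_sub] at h
  have h1 := Real.sin_sq_add_cos_sq a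
  have h2 := Real.sin_sq_add_cos_sq b
  rw [sq_abs]
  simp
  nlinarith

lemma circG_mem (t : ℝ) : circG t ∈ Metric.sphere (0 : EuclideanSpace ℝ (Fin 2)) 1 := by
  rw [mem_sphere_zero_iff_norm, EuclideanSpace.norm_eq]
  simp [circG, Fin.sum_univ_two]

lemma circG_surj (x : EuclideanSpace ℝ (Fin 2))
    (hx : x ∈ Metric.sphere (0 : EuclideanSpace ℝ (Fin 2)) 1) :
    ∃ t ∈ Ioc (-Real.pi) Real.pi, circG t = x := by
  rw [mem_sphere_zero_iff_norm, EuclideanSpace.norm_eq] at hx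
  simp only [Fin.sum_univ_two, Real.norm_eq_abs, sq_abs] at hx
  have hn : ‖(⟨x 0, x 1⟩ : ℂ)‖ = 1 := by
    rw [Complex.norm_eq_sqrt_sq_add_sq]; exact hx
  have hz : (⟨x 0, x 1⟩ : ℂ) ≠ 0 := by
    intro h; rw [h] at hn; simp at hn
  refine ⟨Complex.arg ⟨x 0, x 1⟩, Complex.arg_mem_Ioc _, ?_⟩
  ext i
  fin_cases i
  · simp [circG, Complex.cos_arg hz, hn]
  · simp [circG, Complex.sin_arg, hn]

lemma circG_ne {s t : ℝ} (h1 : s < t) (h2 : t < s + 2 * Real.pi) : circG s ≠ circG t := by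
  intro h
  have hc : Real.cos s = Real.cos t := by simpa [circG] using congrArg (fun v => v 0) h
  have hs : Real.sin s = Real.sin t := by simpa [circG] using congrArg (fun v => v 1) h
  have h3 : Real.cos (t - s) = 1 := by
    rw [Real.cos_sub, hc, hs]
    nlinarith [Real.sin_sq_add_cos_sq t]
  have := (Real.cos_eq_one_iff_of_lt_of_lt (by linarith [Real.pi_pos]) (by linarith)).1 h3
  linarith

lemma circG_periodic (t : ℝ) : circG (t + 2 * Real.pi) = circG t := by
  simp [circG]

lemma sphere_le : μH[(1 : ℝ)] (Metric.sphere (0 : EuclideanSpace ℝ (Fin 2)) 1) ≤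
    ENNReal.ofReal (2 * Real.pi) := by
  have hsub : Metric.sphere (0 : EuclideanSpace ℝ (Fin 2)) 1 ⊆
      circG '' Ioc (-Real.pi) Real.pi := fun x hx => circG_surj x hx
  refine (measure_mono hsub).trans ?_
  refine (circG_lip.hausdorffMeasure_image_le zero_le_one _).trans ?_
  rw [hausdorffMeasure_real, Real.volume_Ioc]
  simp only [ENNReal.coe_one, ENNReal.one_rpow, one_mul]
  apply ENNReal.ofReal_le_ofReal
  linarith

/-- **Example 3.5.** No Lipschitz function `φ : S¹ → ℝ` is injective on a Borel set of full
measure with respect to the normalized arc-length (1-dimensional Hausdorff) probability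
measure on the unit circle `S¹ ⊆ ℝ²`. -/
theorem circle_no_injective_lipschitz
    (φ : EuclideanSpace ℝ (Fin 2) → ℝ)
    (hφ : ∃ C > (0 : ℝ), ∀ x ∈ Metric.sphere (0 : EuclideanSpace ℝ (Fin 2)) 1,
      ∀ y ∈ Metric.sphere (0 : EuclideanSpace ℝ (Fin 2)) 1, |φ x - φ y| ≤ C * ‖x - y‖)
    (A : Set (EuclideanSpace ℝ (Fin 2))) (hA : MeasurableSet A)
    (hAS : A ⊆ Metric.sphere (0 : EuclideanSpace ℝ (Fin 2)) 1)
    (hfull : ((ENNReal.ofReal (2 * Real.pi))⁻¹ •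
        (μH[(1 : ℝ)]).restrict (Metric.sphere (0 : EuclideanSpace ℝ (Fin 2)) 1)) A = 1) :
    ¬ Set.InjOn φ A := by
  intro hinj
  obtain ⟨C, hC, hlip⟩ := hφ
  set S := Metric.sphere (0 : EuclideanSpace ℝ (Fin 2)) 1 with hS
  have hL : LipschitzOnWith C.toNNReal φ S := by
    apply LipschitzOnWith.of_dist_le_mul
    intro x hx y hy
    rw [Real.dist_eq, dist_eq_norm, Real.coe_toNNReal _ hC.le]
    exact hlip x hx y hy
  have hpi : 0 < 2 * Real.pi := by positivity
  have hA1 : μH[(1 : ℝ)] A = ENNReal.ofReal (2 * Real.pi) := by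
    rw [Measure.smul_apply, Measure.restrict_apply hA, inter_eq_left.2 hAS, smul_eq_mul] at hfull
    have h0 : ENNReal.ofReal (2 * Real.pi) ≠ 0 := by simpa using Real.pi_pos
    have := congrArg (fun z => ENNReal.ofReal (2 * Real.pi) * z) hfull
    simpa only [← mul_assoc, ENNReal.mul_inv_cancel h0 ENNReal.ofReal_ne_top, one_mul,
      mul_one] using this
  have hN : μH[(1 : ℝ)] (S \ A) = 0 := by
    rw [measure_sdiff hAS hA.nullMeasurableSet (by rw [hA1]; exact ENNReal.ofReal_ne_top), hA1]
    exact tsub_eq_zero_of_le sphere_le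
  have hN2 : volume (φ '' (S \ A)) = 0 := by
    rw [← hausdorffMeasure_real]
    have := (hL.mono (sdiff_subset (s := S) (t := A))).hausdorffMeasure_image_le
      (zero_le_one (α := ℝ))
    rw [hN, mul_zero] at this
    exact le_antisymm this zero_le
  have hnt : A.Nontrivial := by
    by_contra h
    rw [not_nontrivial_iff] at h
    have h2 : μH[(1 : ℝ)] A = 0 := by
      have := Measure.nullSingletonClass_hausdorff (EuclideanSpace ℝ (Fin 2)) (d := 1) one_pos
      exact h.measure_zero _
    rw [hA1] at h2
    simp only [ENNReal.ofReal_eq_zero] at h2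
    linarith
  have hfc : Continuous (fun t => φ (circG t)) :=
    hL.continuousOn.comp_continuous circG_lip.continuous circG_mem
  have key : ∀ a ∈ Ioc (-Real.pi) Real.pi, ∀ b ∈ Ioc (-Real.pi) Real.pi, a < b →
      circG a ∈ A → circG b ∈ A → False := by
    intro a ha b hb hab haA hbA
    have hba : b < a + 2 * Real.pi := by linarith [ha.1, hb.2]
    have hne : φ (circG a) ≠ φ (circG b) := fun h => circG_ne hab hba (hinj haA hbA h)
    obtain ⟨t, ht, htN⟩ : ∃ t ∈ Ioo (min (φ (circG a)) (φ (circG b)))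
        (max (φ (circG a)) (φ (circG b))), t ∉ φ '' (S \ A) := by
      by_contra! h
      have h3 := measure_mono_null (μ := volume) h hN2
      rw [Real.volume_Ioo, ENNReal.ofReal_eq_zero] at h3
      have := min_lt_max.2 hne
      linarith
    have hmem : ∀ s, φ (circG s) = t → circG s ∈ A := by
      intro s hs
      by_contra h
      exact htN ⟨_, ⟨circG_mem s, h⟩, hs⟩
    have hta : t ≠ φ (circG a) := by
      rintro rfl
      have h1 := ht.1
      have h2 := ht.2
      rcases le_total (φ (circG a)) (φ (circG b)) with h | h
      · rw [min_eq_left h] at h1; exact lt_irrefl _ h1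
      · rw [max_eq_left h] at h2; exact lt_irrefl _ h2
    have htb : t ≠ φ (circG b) := by
      rintro rfl
      have h1 := ht.1
      have h2 := ht.2
      rcases le_total (φ (circG a)) (φ (circG b)) with h | h
      · rw [max_eq_right h] at h2; exact lt_irrefl _ h2
      · rw [min_eq_right h] at h1; exact lt_irrefl _ h1
    obtain ⟨s₁, hs₁, e₁⟩ := intermediate_value_uIcc (a := a) (b := b)
      (f := fun t => φ (circG t)) hfc.continuousOn (Ioo_subset_Icc_self ht)
    obtain ⟨s₂, hs₂, e₂⟩ := intermediate_value_uIcc (a := b) (b := a + 2 * Real.pi)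
      (f := fun t => φ (circG t)) hfc.continuousOn
      (by rw [circG_periodic, uIcc_comm]; exact Ioo_subset_Icc_self ht)
    rw [uIcc_of_le hab.le] at hs₁
    rw [uIcc_of_le hba.le] at hs₂
    simp only at e₁ e₂
    have n1 : s₁ ≠ b := by rintro rfl; exact htb e₁.symm
    have n2 : s₁ ≠ a := by rintro rfl; exact hta e₁.symm
    have l1 : s₁ < b := lt_of_le_of_ne hs₁.2 n1
    have l2 : a < s₁ := lt_of_le_of_ne hs₁.1 n2.symm
    exact circG_ne (by linarith [hs₂.1] : s₁ < s₂) (by linarith [hs₂.2])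
      (hinj (hmem _ e₁) (hmem _ e₂) (e₁.trans e₂.symm))
  obtain ⟨x, hx, y, hy, hxy⟩ := hnt
  obtain ⟨a, ha, rfl⟩ := circG_surj x (hAS hx)
  obtain ⟨b, hb, rfl⟩ := circG_surj y (hAS hy)
  rcases lt_trichotomy a b with h | h | h
  · exact key a ha b hb h hx hy
  · exact hxy (by rw [h])
  · exact key b hb a ha h hy hx
end

section
/- Let X ⊆ ℝ^N, let T : X → X be injective, let k, m ∈ ℕ, and let h_1,…,h_m : X → ℝ be a 2k-interpolating family on X. For x, y ∈ X let D_{x,y} be the k×m real matrix whose (i,j) entry is h_j(T^{i−1}x) − h_j(T^{i−1}y) for i = 1,…,k and j = 1,…,m. Suppose x, y ∈ X with y ∉ Orb(x). Then: (ii) if y ∈ Per_p(T) for some p ∈ {1,…,k−1}, the matrix D_{x,y} has rank at least p; (iii) if y ∉ Per_p(T) for all p ∈ {1,…,k−1}, then D_{x,y} has rank exactly k. -/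
open Set

/-- The full orbit of `x` under an injective map `T : X → X`:
`Orb(x) = {Tⁿx : n ≥ 0} ∪ {y ∈ X : Tⁿy = x for some n ≥ 1}`. -/
def FullOrbit {E : Type*} (T : E → E) (X : Set E) (x : E) : Set E :=
  {y | ∃ n : ℕ, T^[n] x = y} ∪ {y ∈ X | ∃ n : ℕ, 1 ≤ n ∧ T^[n] y = x}

lemma interp_exists {E : Type*} {m K : ℕ} {X : Set E} {h : Fin m → E → ℝ}
    (hi : IsInterpolatingFamily X h K) (S : Finset E) (hS : ∀ z ∈ S, z ∈ X) (hc : S.card ≤ K)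
    (g : E → ℝ) : ∃ a : Fin m → ℝ, ∀ z ∈ S, ∑ j, h j z * a j = g z := by
  have hr := hi S.card hc (fun i => (S.equivFin.symm i : E)) (fun i => hS _ (S.equivFin.symm i).2)
    (fun i j hij => S.equivFin.symm.injective (Subtype.ext hij))
  have ht : LinearMap.range (Matrix.of fun (i : Fin S.card) (j : Fin m) =>
      h j (S.equivFin.symm i : E)).mulVecLin = ⊤ := by
    apply Submodule.eq_top_of_finrank_eq
    rw [Module.finrank_fin_fun]
    exact hr
  obtain ⟨a, ha⟩ := LinearMap.range_eq_top.1 ht (fun i => g (S.equivFin.symm i : E))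
  refine ⟨a, fun z hz => ?_⟩
  have := congrFun ha (S.equivFin ⟨z, hz⟩)
  simpa [Matrix.mulVec, dotProduct] using this

lemma iter_cancel {E : Type*} {X : Set E} {T : E → E} (hTX : Set.MapsTo T X X)
    (hT : Set.InjOn T X) (n : ℕ) {u v : E} (hu : u ∈ X) (hv : v ∈ X)
    (h : T^[n] u = T^[n] v) : u = v := by
  induction n with
  | zero => exact h
  | succ n ih =>
    rw [Function.iterate_succ_apply', Function.iterate_succ_apply'] at h
    exact ih (hT (hTX.iterate n hu) (hTX.iterate n hv) h)

lemma key {E : Type*} {k m : ℕ} (X : Set E) (T : E → E)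
    (hTX : Set.MapsTo T X X) (hTinj : Set.InjOn T X) (h : Fin m → E → ℝ)
    (hinterp : IsInterpolatingFamily X h (2 * k))
    (x y : E) (hx : x ∈ X) (hy : y ∈ X) (hyOrb : y ∉ FullOrbit T X x)
    (q : ℕ) (hq : q ≤ k) (hper : ∀ d, 1 ≤ d → d < q → T^[d] y ≠ y) :
    q ≤ (Matrix.of fun (i : Fin k) (j : Fin m) =>
        h j (T^[(i : ℕ)] x) - h j (T^[(i : ℕ)] y)).rank := by
  classical
  have hne : ∀ i j : ℕ, T^[i] x ≠ T^[j] y := by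
    intro i j hij
    apply hyOrb
    rcases le_total i j with hl | hl
    · obtain ⟨d, rfl⟩ := Nat.exists_eq_add_of_le hl
      rw [Function.iterate_add_apply] at hij
      have := iter_cancel hTX hTinj i hx (hTX.iterate d hy) hij
      rcases Nat.eq_zero_or_pos d with rfl | hd
      · exact Or.inl ⟨0, this⟩
      · exact Or.inr ⟨hy, d, hd, this.symm⟩
    · obtain ⟨d, rfl⟩ := Nat.exists_eq_add_of_le hl
      rw [Function.iterate_add_apply] at hij
      exact Or.inl ⟨d, iter_cancel hTX hTinj j (hTX.iterate d hx) hy hij⟩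
  have hlt : ∀ i j : ℕ, i < j → j < q → T^[i] y ≠ T^[j] y := by
    intro i j hl hj hij
    obtain ⟨d, rfl⟩ := Nat.exists_eq_add_of_le hl.le
    rw [Function.iterate_add_apply] at hij
    exact hper d (by omega) (by omega)
      (iter_cancel hTX hTinj i hy (hTX.iterate d hy) hij).symm
  have hinj : ∀ i j : Fin q, T^[(i : ℕ)] y = T^[(j : ℕ)] y → i = j := by
    intro i j hij
    rcases lt_trichotomy (i : ℕ) j with hl | hl | hl
    · exact absurd hij (hlt _ _ hl j.2)
    · exact Fin.ext hl
    · exact absurd hij.symm (hlt _ _ hl i.2)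
  set D := Matrix.of fun (i : Fin k) (j : Fin m) =>
        h j (T^[(i : ℕ)] x) - h j (T^[(i : ℕ)] y) with hD
  let S : Finset E := (Finset.univ.image fun i : Fin q => T^[(i : ℕ)] x) ∪
    (Finset.univ.image fun i : Fin q => T^[(i : ℕ)] y)
  have hSX : ∀ z ∈ S, z ∈ X := by
    intro z hz
    simp only [S, Finset.mem_union, Finset.mem_image, Finset.mem_univ, true_and] at hz
    rcases hz with ⟨i, rfl⟩ | ⟨i, rfl⟩
    · exact hTX.iterate _ hx
    · exact hTX.iterate _ hy
  have hSc : S.card ≤ 2 * k := by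
    have h0 := Finset.card_union_le (Finset.univ.image fun i : Fin q => T^[(i : ℕ)] x)
      (Finset.univ.image fun i : Fin q => T^[(i : ℕ)] y)
    have h1 := Finset.card_image_le (s := Finset.univ) (f := fun i : Fin q => T^[(i : ℕ)] x)
    have h2 := Finset.card_image_le (s := Finset.univ) (f := fun i : Fin q => T^[(i : ℕ)] y)
    simp only [Finset.card_univ, Fintype.card_fin] at h1 h2
    change S.card ≤ _ at h0
    omega
  have hli : LinearIndependent ℝ (fun i : Fin q => D.row (Fin.castLE hq i)) := by
    rw [Fintype.linearIndependent_iff]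
    intro c hc i0
    obtain ⟨a, ha⟩ := interp_exists hinterp S hSX hSc
      (fun z => if z = T^[(i0 : ℕ)] y then 1 else 0)
    have hrow : ∀ i : Fin q, ∑ j, D (Fin.castLE hq i) j * a j = if i = i0 then -1 else 0 := by
      intro i
      have h1 := ha (T^[(i : ℕ)] x) (by simp [S])
      have h2 := ha (T^[(i : ℕ)] y) (by simp [S])
      rw [if_neg (hne _ _)] at h1
      simp only [hD, Matrix.of_apply, Fin.val_castLE, sub_mul, Finset.sum_sub_distrib, h1, h2]
      by_cases hi : i = i0
      · simp [hi]
      · rw [if_neg (fun e => hi (hinj _ _ e)), if_neg hi, sub_zero]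
    have h3 : ∑ i, c i * ∑ j, D (Fin.castLE hq i) j * a j = 0 := by
      simp only [Finset.mul_sum]
      rw [Finset.sum_comm]
      apply Finset.sum_eq_zero
      intro j _
      have := congrFun hc j
      simp only [Finset.sum_apply, Pi.smul_apply, Matrix.row_apply, smul_eq_mul,
        Pi.zero_apply] at this
      simp only [← mul_assoc]
      rw [← Finset.sum_mul, this, zero_mul]
    simp only [hrow] at h3
    simpa using h3
  rw [Matrix.rank_eq_finrank_span_row]
  have h4 := finrank_span_eq_card hli
  rw [Fintype.card_fin] at h4
  rw [← h4]
  apply Submodule.finrank_mono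
  apply Submodule.span_mono
  rintro _ ⟨i, rfl⟩
  exact ⟨_, rfl⟩

/-- **Lemma 4.3(ii)–(iii).** Let `h₁,…,h_m` be a `2k`-interpolating family on `X ⊆ ℝ^N`,
`T : X → X` injective, `x, y ∈ X` with `y ∉ Orb(x)`, and let
`D_{x,y} = (h_j(T^{i−1}x) − h_j(T^{i−1}y))_{i,j}` be the `k × m` delay matrix. Then:
(ii) if `y ∈ Per_p(T)` for some `p ∈ {1,…,k−1}`, then `rank D_{x,y} ≥ p`; and
(iii) if `y ∉ Per_p(T)` for all `p ∈ {1,…,k−1}`, then `rank D_{x,y} = k`. -/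
theorem interpolating_delay_matrix_rank {N k m : ℕ} (hk : 1 ≤ k)
    (X : Set (EuclideanSpace ℝ (Fin N)))
    (T : EuclideanSpace ℝ (Fin N) → EuclideanSpace ℝ (Fin N))
    (hTX : Set.MapsTo T X X) (hTinj : Set.InjOn T X)
    (hfam : Fin m → EuclideanSpace ℝ (Fin N) → ℝ)
    (hinterp : IsInterpolatingFamily X hfam (2 * k))
    (x y : EuclideanSpace ℝ (Fin N)) (hx : x ∈ X) (hy : y ∈ X)
    (hyOrb : y ∉ FullOrbit T X x) :
    (∀ p : ℕ, 1 ≤ p → p < k → y ∈ PerSet T X p →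
      p ≤ (Matrix.of fun (i : Fin k) (j : Fin m) =>
        hfam j (T^[(i : ℕ)] x) - hfam j (T^[(i : ℕ)] y)).rank) ∧
    ((∀ p : ℕ, 1 ≤ p → p < k → y ∉ PerSet T X p) →
      (Matrix.of fun (i : Fin k) (j : Fin m) =>
        hfam j (T^[(i : ℕ)] x) - hfam j (T^[(i : ℕ)] y)).rank = k) := by
  refine ⟨fun p _ hpk hp => key X T hTX hTinj hfam hinterp x y hx hy hyOrb p hpk.le hp.2.2,
    fun hn => le_antisymm ?_ (key X T hTX hTinj hfam hinterp x y hx hy hyOrb k le_rfl ?_)⟩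
  · simpa using Matrix.rank_le_card_height (Matrix.of fun (i : Fin k) (j : Fin m) =>
        hfam j (T^[(i : ℕ)] x) - hfam j (T^[(i : ℕ)] y))
  · intro d
    induction d using Nat.strong_induction_on with
    | _ d ih =>
      intro h1 hd he
      exact hn d h1 hd ⟨hy, he, fun j hj hjd => ih j hjd hj (hjd.trans hd)⟩
end

section
/- Fix a strictly increasing sequence of positive integers (M_k)_{k≥0} with M_0 = 1 and M_{k+1}/M_k → ∞. Let π : {0,1}^{ℕ≥1} → [0,1] be π(x) = Σ_{j≥1} x_j 2^{−j}. Let A = π(Ã), where Ã is the set of sequences x ∈ {0,1}^{ℕ≥1} such that for every even k ≥ 0 the sequence (x_j) is constant for j ∈ [M_k, M_{k+1}) ∩ ℕ, and let B = π(B̃), where B̃ is defined analogously with odd k. Set X = ({0} × ⋃_{n∈ℤ}(A+n)) ∪ ({1} × ⋃_{n∈ℤ}(B+n)) ⊆ ℝ². Then no linear transformation L : ℝ² → ℝ is injective on X. -/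
open Set Filter

/-- The binary coding map `π(x) = ∑_{j≥1} x_j 2^{−j}` (sequences indexed so that the
`j`-th binary digit is `x j` for `j ≥ 1`). -/
noncomputable def binCode (x : ℕ → ℕ) : ℝ := ∑' j : ℕ, (x (j + 1) : ℝ) / 2 ^ (j + 1)

/-- The set of `{0,1}`-sequences that are constant on every block `[M_k, M_{k+1}) ∩ ℕ`
with `k % 2 = par`. -/
def blockConstant (M : ℕ → ℕ) (par : ℕ) : Set (ℕ → ℕ) :=
  {x | (∀ j, x j ≤ 1) ∧ ∀ k : ℕ, k % 2 = par →
    ∀ i j : ℕ, M k ≤ i → i < M (k + 1) → M k ≤ j → j < M (k + 1) → x i = x j}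

/-- `A = π(Ã)`: blocks with even `k` are constant. -/
def KanA (M : ℕ → ℕ) : Set ℝ := binCode '' blockConstant M 0

/-- `B = π(B̃)`: blocks with odd `k` are constant. -/
def KanB (M : ℕ → ℕ) : Set ℝ := binCode '' blockConstant M 1

/-- The modified Kan set `X = ({0} × ⋃_{n∈ℤ}(A+n)) ∪ ({1} × ⋃_{n∈ℤ}(B+n)) ⊆ ℝ²`. -/
def KanX (M : ℕ → ℕ) : Set (ℝ × ℝ) :=
  ({(0 : ℝ)} ×ˢ ⋃ n : ℤ, (fun a => a + (n : ℝ)) '' KanA M) ∪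
  ({(1 : ℝ)} ×ˢ ⋃ n : ℤ, (fun a => a + (n : ℝ)) '' KanB M)


theorem kan_aux_half : HasSum (fun j : ℕ => (1 : ℝ) / 2 ^ (j + 1)) 1 := by
  have h := hasSum_geometric_two' (1 : ℝ)
  convert h using 2 with j
  rw [pow_succ, div_div, mul_comm]

theorem kan_aux_summable (x : ℕ → ℕ) (hx : ∀ j, x j ≤ 1) :
    Summable (fun j : ℕ => (x (j + 1) : ℝ) / 2 ^ (j + 1)) := by
  refine Summable.of_nonneg_of_le (fun j => by positivity) (fun j => ?_) kan_aux_half.summable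
  have : (x (j + 1) : ℝ) ≤ 1 := by exact_mod_cast hx _
  gcongr

theorem kan_aux_digits (t : ℝ) (ht : t ∈ Set.Ico (0 : ℝ) 1) :
    ∃ x : ℕ → ℕ, (∀ j, x j ≤ 1) ∧ binCode x = t := by
  refine ⟨fun j => (Real.digits t 2 (j - 1) : ℕ), fun j => Nat.le_of_lt_succ (Real.digits t 2 (j - 1)).isLt, ?_⟩
  have h := Real.ofDigits_digits (b := 2) (x := t) (by norm_num) ht
  refine Eq.trans ?_ h
  unfold binCode Real.ofDigits
  refine tsum_congr fun j => ?_
  simp [Real.ofDigitsTerm, div_eq_mul_inv]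

theorem kan_aux_diff (M : ℕ → ℕ) (hM : StrictMono M) (t : ℝ) :
    ∃ a ∈ KanA M, ∃ b ∈ KanB M, ∃ n : ℤ, a + n = t + b := by
  classical
  obtain ⟨x, hx, hxt⟩ := kan_aux_digits (Int.fract t) ⟨Int.fract_nonneg t, Int.fract_lt_one t⟩
  let P : ℕ → Prop := fun j => ∃ k, k % 2 = 1 ∧ M k ≤ j ∧ j < M (k + 1)
  let u : ℕ → ℕ := fun j => if P j then x j else 0
  let v : ℕ → ℕ := fun j => if P j then 1 else 1 - x j
  have hu : ∀ j, u j ≤ 1 := fun j => by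
    have := hx j
    simp only [u]; split_ifs <;> omega
  have hv : ∀ j, v j ≤ 1 := fun j => by
    simp only [v]; split_ifs <;> omega
  have hnP : ∀ k, k % 2 = 0 → ∀ j, M k ≤ j → j < M (k + 1) → ¬ P j := by
    rintro k hk j h1 h2 ⟨l, hl, h3, h4⟩
    have e1 : k < l + 1 := hM.lt_iff_lt.1 (lt_of_le_of_lt h1 h4)
    have e2 : l < k + 1 := hM.lt_iff_lt.1 (lt_of_le_of_lt h3 h2)
    omega
  refine ⟨binCode u, ⟨u, ⟨hu, ?_⟩, rfl⟩, binCode v, ⟨v, ⟨hv, ?_⟩, rfl⟩, ⌊t⌋ + 1, ?_⟩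
  · intro k hk i j hi hi' hj hj'
    simp [u, hnP k hk i hi hi', hnP k hk j hj hj']
  · intro k hk i j hi hi' hj hj'
    have p1 : P i := ⟨k, hk, hi, hi'⟩
    have p2 : P j := ⟨k, hk, hj, hj'⟩
    simp [v, p1, p2]
  · have key : binCode u + 1 = binCode x + binCode v := by
      have h1 := (kan_aux_summable u hu).hasSum.add kan_aux_half
      have h2 := (kan_aux_summable x hx).hasSum.add (kan_aux_summable v hv).hasSum
      refine h1.unique ?_
      refine Eq.subst (motive := fun f => HasSum f (binCode x + binCode v)) (funext fun j => ?_) h2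
      have : u (j + 1) + 1 = x (j + 1) + v (j + 1) := by
        have := hx (j + 1)
        simp only [u, v]; split_ifs <;> omega
      have h' : (u (j + 1) : ℝ) + 1 = x (j + 1) + v (j + 1) := by exact_mod_cast this
      simp only [← add_div, h']
    have := Int.floor_add_fract t
    push_cast
    linarith

/-- **Proposition 5.1.** For `(M_k)` strictly increasing with `M_0 = 1` and
`M_{k+1}/M_k → ∞`, no linear transformation `L : ℝ² → ℝ` is injective on the modified
Kan set `X`. -/
theorem kan_no_linear_injection (M : ℕ → ℕ) (hM : StrictMono M) (hM0 : M 0 = 1)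
    (hMratio : Tendsto (fun k => (M (k + 1) : ℝ) / (M k : ℝ)) atTop atTop)
    (L : (ℝ × ℝ) →ₗ[ℝ] ℝ) :
    ¬ Set.InjOn L (KanX M) := by
  intro hinj
  have hL : ∀ p q : ℝ, L (p, q) = p * L (1, 0) + q * L (0, 1) := by
    intro p q
    have : ((p, q) : ℝ × ℝ) = p • ((1, 0) : ℝ × ℝ) + q • ((0, 1) : ℝ × ℝ) := by simp
    rw [this, map_add, map_smul, map_smul, smul_eq_mul, smul_eq_mul]
  have hA : ∀ a ∈ KanA M, ∀ n : ℤ, ((0 : ℝ), a + n) ∈ KanX M := fun a ha n =>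
    Or.inl ⟨rfl, Set.mem_iUnion.2 ⟨n, a, ha, rfl⟩⟩
  have hB : ∀ a ∈ KanB M, ∀ n : ℤ, ((1 : ℝ), a + n) ∈ KanX M := fun a ha n =>
    Or.inr ⟨rfl, Set.mem_iUnion.2 ⟨n, a, ha, rfl⟩⟩
  obtain ⟨a, ha, b, hb, n, h⟩ := kan_aux_diff M hM (L (1, 0) / L (0, 1))
  by_cases hβ : L (0, 1) = 0
  · have := hinj (hA a ha 0) (hA a ha 1) (by rw [hL 0 (a + (0:ℤ)), hL 0 (a + (1:ℤ)), hβ]; simp)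
    simp at this
  · have := hinj (hA a ha n) (hB b hb 0) (by
      rw [hL 0 (a + n), hL 1 (b + (0:ℤ)), h]
      push_cast
      field_simp
      ring)
    simp at this
end

section
/- There exists a Borel probability measure μ on [0,1]² ⊆ ℝ² with the following two properties. (i) The infimum of dim_H S over all Borel sets S ⊆ [0,1]² with μ(S) = 1 equals 1 (that is, the Hausdorff dimension of μ is 1). (ii) For every Borel set A ⊆ [0,1]² with μ(A) > 0 and every ε ∈ (0,2) there exists n₀ ∈ ℕ such that for all n ≥ n₀, every finite family of subsets of ℝ², each of diameter at most 2^{−n}, whose union covers A has at least 2^{(2−ε)n} members (that is, every set of positive μ-measure has lower box-counting dimension 2, so the lower modified box-counting dimension of μ is 2). -/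
open MeasureTheory Set
open scoped ENNReal

namespace Constr
open scoped Nat

abbrev Bt := ℕ → Fin 2

def pref (b : Bt) : ℕ → ℕ
  | 0 => 0
  | n + 1 => 2 * pref b n + (b n).val

lemma pref_inj {b b' : Bt} : ∀ {n : ℕ}, pref b n = pref b' n → ∀ m < n, b m = b' m
  | 0, _, m, hm => by omega
  | n + 1, h, m, hm => by
    simp only [pref] at h
    have h1 := (b n).isLt
    have h2 := (b' n).isLt
    rcases Nat.lt_succ_iff_lt_or_eq.1 hm with h3 | rfl
    · exact pref_inj (n := n) (by omega) m h3
    · exact Fin.ext (by omega)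

lemma pref_lt (b : Bt) : ∀ n, pref b n < 2 ^ n
  | 0 => by simp [pref]
  | n + 1 => by
    have := pref_lt b n
    have := (b n).isLt
    simp only [pref, pow_succ]; omega

lemma pref_zero (b : Bt) (n : ℕ) : ∀ l, (∀ m, n ≤ m → m < n + l → b m = 0) →
    pref b (n + l) = 2 ^ l * pref b n
  | 0, _ => by simp
  | l + 1, h => by
    have h1 := pref_zero b n l (fun m hm hm' => h m hm (by omega))
    have h2 := h (n + l) (by omega) (by omega)
    rw [← add_assoc, pref, h1, h2, pow_succ]; simp; ring

lemma sum_term (b : Bt) (n : ℕ) :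
    ∑ i ∈ Finset.range n, Real.ofDigitsTerm b i = pref b n / 2 ^ n := by
  induction n with
  | zero => simp [pref]
  | succ n ih =>
    rw [Finset.sum_range_succ, ih, pref, Real.ofDigitsTerm]
    push_cast
    field_simp
    ring

lemma val_bounds (b : Bt) (n : ℕ) :
    (pref b n : ℝ) ≤ 2 ^ n * Real.ofDigits b ∧ 2 ^ n * Real.ofDigits b ≤ pref b n + 1 := by
  have h := Real.ofDigits_eq_sum_add_ofDigits b n
  rw [sum_term] at h
  have h0 := Real.ofDigits_nonneg (fun i ↦ b (i + n))
  have h1 := Real.ofDigits_le_one (fun i ↦ b (i + n))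
  have h2 : 2 ^ n * Real.ofDigits b = pref b n + Real.ofDigits (fun i ↦ b (i + n)) := by
    rw [h]; push_cast; field_simp
  constructor <;> linarith

lemma measurable_pref (n : ℕ) : Measurable (fun b : Bt => pref b n) := by
  induction n with
  | zero => simp [pref]
  | succ n ih =>
    simp only [pref]
    have : Measurable (fun b : Bt => (b n).val) :=
      (measurable_from_top (f := fun x : Fin 2 => x.val)).comp (measurable_pi_apply n)
    exact (ih.const_mul 2).add this

noncomputable def coin : Measure (Fin 2) := (PMF.uniformOfFintype (Fin 2)).toMeasure

instance : IsProbabilityMeasure coin := by unfold coin; infer_instance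

lemma coin_singleton (x : Fin 2) : coin {x} = 2⁻¹ := by
  rw [coin, PMF.toMeasure_uniformOfFintype_apply _ (measurableSet_singleton x)]
  simp

noncomputable def PB : Measure Bt := Measure.infinitePi (fun _ => coin)

instance : IsProbabilityMeasure PB := by unfold PB; infer_instance

lemma PB_cyl (F : Finset ℕ) (c : Bt) : PB {b | ∀ m ∈ F, b m = c m} = (2⁻¹ : ℝ≥0∞) ^ F.card := by
  have : {b : Bt | ∀ m ∈ F, b m = c m} = Set.pi F (fun m => {c m}) := by
    ext b; simp [Set.pi]
  rw [this, PB, Measure.infinitePi_pi _ (fun i _ => measurableSet_singleton _)]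
  simp [coin_singleton]

def isBad (c : Bt) (k : ℕ) : Prop := pref c (Nat.log 2 k) + 2 ^ (Nat.log 2 k) = k
def masked (c : Bt) (m : ℕ) : Prop := ∃ k, isBad c k ∧ k ! ≤ m ∧ m < 2 * (k !)

open Classical in
noncomputable def msk (c b : Bt) : Bt := fun m => if masked c m then 0 else b m

noncomputable def XX (w : Bt × (Bt × Bt)) : ℝ × ℝ :=
  (Real.ofDigits (msk w.1 w.2.1), Real.ofDigits (msk w.1 w.2.2))

noncomputable def PP : Measure (Bt × (Bt × Bt)) := PB.prod (PB.prod PB)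

instance : IsProbabilityMeasure PP := by unfold PP; infer_instance

lemma isBad_pos {c : Bt} {k : ℕ} (h : isBad c k) : 1 ≤ k := by
  unfold isBad at h
  have : 0 < 2 ^ (Nat.log 2 k) := by positivity
  omega

lemma exists_bad (c : Bt) (K : ℕ) : ∃ k, K ≤ k ∧ isBad c k := by
  refine ⟨pref c K + 2 ^ K, ?_, ?_⟩
  · have := Nat.lt_two_pow_self (n := K); omega
  · have h := pref_lt c K
    have : Nat.log 2 (pref c K + 2 ^ K) = K := by
      rw [Nat.log_eq_iff (Or.inr ⟨by norm_num, by positivity⟩)]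
      constructor
      · omega
      · rw [pow_succ]; omega
    unfold isBad
    rw [this]

lemma meas_bad (k : ℕ) : MeasurableSet {c : Bt | isBad c k} := by
  unfold isBad
  exact measurableSet_eq_fun ((measurable_pref _).add_const _) measurable_const

lemma meas_masked (m : ℕ) : MeasurableSet {c : Bt | masked c m} := by
  have : {c : Bt | masked c m} = ⋃ k, ({c | isBad c k} ∩ {_c | k ! ≤ m ∧ m < 2 * (k !)}) := by
    ext c; simp [masked]
  rw [this]
  exact MeasurableSet.iUnion fun k => (meas_bad k).inter (MeasurableSet.const _)

lemma meas_msk : Measurable (fun w : Bt × Bt => msk w.1 w.2) := by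
  classical
  refine measurable_pi_iff.2 fun m => ?_
  unfold msk
  refine Measurable.ite ((meas_masked m).preimage measurable_fst) measurable_const ?_
  exact (measurable_pi_apply m).comp measurable_snd

lemma meas_m1 : Measurable (fun w : Bt × (Bt × Bt) => msk w.1 w.2.1) :=
  meas_msk.comp (measurable_fst.prodMk (measurable_fst.comp measurable_snd))
lemma meas_m2 : Measurable (fun w : Bt × (Bt × Bt) => msk w.1 w.2.2) :=
  meas_msk.comp (measurable_fst.prodMk (measurable_snd.comp measurable_snd))

lemma meas_X : Measurable XX :=
  (Real.continuous_ofDigits.measurable.comp meas_m1).prodMk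
    (Real.continuous_ofDigits.measurable.comp meas_m2)

lemma PB_bad (k : ℕ) : PB {c | isBad c k} ≤ (2⁻¹ : ℝ≥0∞) ^ (Nat.log 2 k) := by
  rcases Set.eq_empty_or_nonempty {c | isBad c k} with h | ⟨c0, h0⟩
  · simp [h]
  · have := PB_cyl (Finset.range (Nat.log 2 k)) c0
    rw [Finset.card_range] at this
    rw [← this]
    apply measure_mono
    intro c hc m hm
    simp only [isBad, mem_ofPred_eq] at h0 hc
    exact pref_inj (n := Nat.log 2 k) (by omega) m (Finset.mem_range.1 hm)

lemma PB_pref (c : Bt) (n v : ℕ) (F : Finset ℕ) (hF : ∀ m ∈ F, m < n ∧ ¬ masked c m) :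
    PB {b | pref (msk c b) n = v} ≤ (2⁻¹ : ℝ≥0∞) ^ F.card := by
  rcases Set.eq_empty_or_nonempty {b | pref (msk c b) n = v} with h | ⟨b0, h0⟩
  · simp [h]
  · rw [← PB_cyl F b0]
    apply measure_mono
    intro b hb m hm
    simp only [mem_ofPred_eq] at h0 hb
    have := pref_inj (hb.trans h0.symm) m (hF m hm).1
    simpa [msk, (hF m hm).2] using this

lemma close_pref {b b' : Bt} {n : ℕ}
    (h : |Real.ofDigits b - Real.ofDigits b'| ≤ (2 : ℝ)⁻¹ ^ n) :
    pref b n ∈ Finset.Icc (pref b' n - 2) (pref b' n + 2) := by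
  obtain ⟨h1, h2⟩ := val_bounds b n
  obtain ⟨h3, h4⟩ := val_bounds b' n
  have h5 : |2 ^ n * Real.ofDigits b - 2 ^ n * Real.ofDigits b'| ≤ 1 := by
    rw [← mul_sub, abs_mul, abs_of_pos (by positivity : (0:ℝ) < 2 ^ n)]
    calc _ ≤ (2:ℝ) ^ n * (2 : ℝ)⁻¹ ^ n := by gcongr
      _ = 1 := by rw [← mul_pow]; norm_num
  rw [abs_le] at h5
  have h6 : (pref b n : ℝ) ≤ pref b' n + 2 := by linarith
  have h7 : (pref b' n : ℝ) ≤ pref b n + 2 := by linarith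
  have h6' : pref b n ≤ pref b' n + 2 := by exact_mod_cast h6
  have h7' : pref b' n ≤ pref b n + 2 := by exact_mod_cast h7
  rw [Finset.mem_Icc]; omega

lemma PP_cell (G : Set Bt) (hG : MeasurableSet G) (n f v1 v2 : ℕ)
    (hF : ∀ c ∈ G, ∃ F : Finset ℕ, f ≤ F.card ∧ ∀ m ∈ F, m < n ∧ ¬ masked c m) :
    PP {w | w.1 ∈ G ∧ pref (msk w.1 w.2.1) n = v1 ∧ pref (msk w.1 w.2.2) n = v2} ≤
      (4⁻¹ : ℝ≥0∞) ^ f := by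
  have hm : MeasurableSet {w : Bt × (Bt × Bt) |
      w.1 ∈ G ∧ pref (msk w.1 w.2.1) n = v1 ∧ pref (msk w.1 w.2.2) n = v2} := by
    refine (hG.preimage measurable_fst).inter (MeasurableSet.inter ?_ ?_)
    · exact measurableSet_eq_fun ((measurable_pref n).comp meas_m1) measurable_const
    · exact measurableSet_eq_fun ((measurable_pref n).comp meas_m2) measurable_const
  rw [PP, Measure.prod_apply hm]
  calc _ ≤ ∫⁻ _c : Bt, (4⁻¹ : ℝ≥0∞) ^ f ∂PB := by
        apply lintegral_mono
        intro c
        by_cases hc : c ∈ G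
        · obtain ⟨F, hf, hF⟩ := hF c hc
          have : (Prod.mk c ⁻¹' {w : Bt × (Bt × Bt) |
              w.1 ∈ G ∧ pref (msk w.1 w.2.1) n = v1 ∧ pref (msk w.1 w.2.2) n = v2}) =
              {b | pref (msk c b) n = v1} ×ˢ {b | pref (msk c b) n = v2} := by
            ext w; simp [hc]
          simp only [this, Measure.prod_prod]
          calc _ ≤ (2⁻¹ : ℝ≥0∞) ^ F.card * (2⁻¹ : ℝ≥0∞) ^ F.card := by
                gcongr <;> exact PB_pref c n _ F hF
            _ = (4⁻¹ : ℝ≥0∞) ^ F.card := by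
                rw [← mul_pow, ← ENNReal.mul_inv (by simp) (by simp)]; norm_num
            _ ≤ _ := by
                apply pow_le_pow_of_le_one (by simp) _ hf
                rw [ENNReal.inv_le_one]; norm_num
        · have : (Prod.mk c ⁻¹' {w : Bt × (Bt × Bt) |
              w.1 ∈ G ∧ pref (msk w.1 w.2.1) n = v1 ∧ pref (msk w.1 w.2.2) n = v2}) = ∅ := by
            ext w; simp [hc]
          simp [this]
    _ = _ := by simp

lemma PP_small (G : Set Bt) (hG : MeasurableSet G) (n f : ℕ)
    (hF : ∀ c ∈ G, ∃ F : Finset ℕ, f ≤ F.card ∧ ∀ m ∈ F, m < n ∧ ¬ masked c m)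
    (U : Set (ℝ × ℝ)) (hU : Metric.ediam U ≤ ENNReal.ofReal ((2 : ℝ)⁻¹ ^ n)) :
    PP {w | w.1 ∈ G ∧ XX w ∈ U} ≤ 25 * (4⁻¹ : ℝ≥0∞) ^ f := by
  rcases Set.eq_empty_or_nonempty {w | w.1 ∈ G ∧ XX w ∈ U} with h | ⟨w0, _, h0⟩
  · simp [h]
  set p1 := pref (msk w0.1 w0.2.1) n
  set p2 := pref (msk w0.1 w0.2.2) n
  set I := Finset.Icc (p1 - 2) (p1 + 2) ×ˢ Finset.Icc (p2 - 2) (p2 + 2) with hI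
  have hsub : {w | w.1 ∈ G ∧ XX w ∈ U} ⊆ ⋃ v ∈ I,
      {w | w.1 ∈ G ∧ pref (msk w.1 w.2.1) n = v.1 ∧ pref (msk w.1 w.2.2) n = v.2} := by
    rintro w ⟨hwG, hw⟩
    have hd : dist (XX w) (XX w0) ≤ (2 : ℝ)⁻¹ ^ n := by
      have := (Metric.edist_le_ediam_of_mem hw h0).trans hU
      rwa [edist_dist, ENNReal.ofReal_le_ofReal_iff (by positivity)] at this
    rw [Prod.dist_eq, max_le_iff] at hd
    simp only [XX, Real.dist_eq] at hd
    simp only [mem_iUnion]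
    exact ⟨(pref (msk w.1 w.2.1) n, pref (msk w.1 w.2.2) n),
      Finset.mem_product.2 ⟨close_pref hd.1, close_pref hd.2⟩, hwG, rfl, rfl⟩
  calc _ ≤ ∑ v ∈ I, PP {w | w.1 ∈ G ∧ pref (msk w.1 w.2.1) n = v.1 ∧
            pref (msk w.1 w.2.2) n = v.2} :=
        (measure_mono hsub).trans (measure_biUnion_finset_le _ _)
    _ ≤ ∑ v ∈ I, (4⁻¹ : ℝ≥0∞) ^ f := Finset.sum_le_sum fun v _ => PP_cell G hG n f _ _ hF
    _ = I.card * (4⁻¹ : ℝ≥0∞) ^ f := by simp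
    _ ≤ _ := by
      gcongr
      have : I.card ≤ 5 * 5 := by
        rw [hI, Finset.card_product, Nat.card_Icc, Nat.card_Icc]
        apply Nat.mul_le_mul <;> omega
      exact_mod_cast this

lemma not_masked_of {c : Bt} {k n m : ℕ} (hn : n ≤ (k + 1)!) (hk : 1 ≤ k) (hm : m < n)
    (h1 : 2 * (k - 1)! ≤ m) (h2 : isBad c k → k ! ≤ m → 2 * (k !) ≤ m) : ¬ masked c m := by
  rintro ⟨j, hj, hj1, hj2⟩
  rcases lt_trichotomy j k with h | rfl | h
  · have := Nat.factorial_le (show j ≤ k - 1 by omega)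
    omega
  · have := h2 hj hj1; omega
  · have := Nat.factorial_le (show k + 1 ≤ j by omega)
    omega

lemma free_good {k n : ℕ} (hk : 1 ≤ k) (hn' : n ≤ (k + 1)!) :
    ∀ c ∈ {c | ¬ isBad c k}, ∃ F : Finset ℕ, n - 2 * (k - 1)! ≤ F.card ∧
      ∀ m ∈ F, m < n ∧ ¬ masked c m := by
  intro c hc
  refine ⟨Finset.Ico (2 * (k - 1)!) n, by simp, fun m hm => ?_⟩
  rw [Finset.mem_Ico] at hm
  exact ⟨hm.2, not_masked_of hn' hk hm.2 hm.1 (fun h => absurd h hc)⟩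

lemma free_all {k n : ℕ} (hk : 1 ≤ k) (hn : k ! ≤ n) (hn' : n ≤ (k + 1)!) :
    ∀ c ∈ (univ : Set Bt), ∃ F : Finset ℕ, (n + 1) / 2 - 2 * (k - 1)! ≤ F.card ∧
      ∀ m ∈ F, m < n ∧ ¬ masked c m := by
  intro c _
  refine ⟨Finset.Ico (2 * (k - 1)!) (k !) ∪ Finset.Ico (2 * (k !)) n, ?_, fun m hm => ?_⟩
  · rw [Finset.card_union_of_disjoint]
    · simp only [Nat.card_Ico]
      omega
    · rw [Finset.disjoint_left]
      intro a ha hb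
      rw [Finset.mem_Ico] at ha hb
      omega
  · have h3 : (k - 1)! ≤ k ! := Nat.factorial_le (by omega)
    rw [Finset.mem_union, Finset.mem_Ico, Finset.mem_Ico] at hm
    have : m < n := by omega
    exact ⟨this, not_masked_of hn' hk this (by omega) (by omega)⟩

lemma exists_fact {K n : ℕ} (h : K ! ≤ n) : ∃ k, K ≤ k ∧ k ! ≤ n ∧ n < (k + 1)! := by
  have hex : ∃ j, n < j ! := ⟨n + 1, Nat.lt_of_lt_of_le (Nat.lt_succ_self n) (Nat.self_le_factorial _)⟩
  have h1 := Nat.find_spec hex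
  have h2 : K < Nat.find hex := by
    by_contra hc
    have := Nat.factorial_le (not_lt.1 hc)
    omega
  have h3 := Nat.find_min hex (m := Nat.find hex - 1) (by omega)
  refine ⟨Nat.find hex - 1, by omega, by omega, ?_⟩
  rwa [Nat.sub_add_cancel (by omega)]

lemma fact_le_div {k n : ℕ} (hk : 1 ≤ k) (h : k ! ≤ n) : ((k - 1)! : ℝ) ≤ n / k := by
  rw [le_div_iff₀ (by exact_mod_cast hk)]
  have h1 := Nat.mul_factorial_pred (n := k) (by omega)
  have : (k - 1)! * k ≤ n := by rw [mul_comm]; omega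
  exact_mod_cast this

lemma four_pow {x : ℝ} {f : ℕ} (h : x ≤ f) :
    (4⁻¹ : ℝ≥0∞) ^ f ≤ ENNReal.ofReal ((2 : ℝ) ^ (-(2 * x))) := by
  have h1 : (4⁻¹ : ℝ≥0∞) ^ f = ENNReal.ofReal ((2 : ℝ) ^ (-(2 * (f : ℝ)))) := by
    rw [Real.rpow_neg (by norm_num), Real.rpow_mul (by norm_num), Real.rpow_natCast,
      ENNReal.ofReal_inv_of_pos (by positivity), ENNReal.ofReal_pow (by positivity), ENNReal.inv_pow]
    norm_num
  rw [h1]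
  apply ENNReal.ofReal_le_ofReal
  apply Real.rpow_le_rpow_of_exponent_le (by norm_num)
  linarith

noncomputable def mu : Measure (ℝ × ℝ) := PP.map XX

instance : IsProbabilityMeasure mu := Measure.isProbabilityMeasure_map meas_X.aemeasurable

lemma mu_apply {A : Set (ℝ × ℝ)} (hA : MeasurableSet A) : mu A = PP (XX ⁻¹' A) :=
  Measure.map_apply meas_X hA

lemma frost {s : ℝ} (hs : s < 1) : ∃ N : ℕ, ∀ n, N ≤ n → ∀ U : Set (ℝ × ℝ),
    Metric.ediam U ≤ ENNReal.ofReal ((2 : ℝ)⁻¹ ^ n) →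
    mu U ≤ 25 * ENNReal.ofReal ((2 : ℝ) ^ (-(s * n))) := by
  obtain ⟨K, hK⟩ := exists_nat_gt (4 / (1 - s))
  have hs' : 0 < 1 - s := by linarith
  have hK0 : (0 : ℝ) < K := lt_trans (by positivity) hK
  have hK1 : 1 ≤ K := by exact_mod_cast hK0
  refine ⟨K !, fun n hn U hU => ?_⟩
  obtain ⟨k, hk, hk1, hk2⟩ := exists_fact hn
  have hk0 : (0 : ℝ) < k := hK0.trans_le (by exact_mod_cast hk)
  have h1 := fact_le_div (hK1.trans hk) hk1
  have h2 : (4 : ℝ) / k ≤ 1 - s := by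
    rw [div_le_iff₀ hk0]
    rw [div_lt_iff₀ hs'] at hK
    have : (K : ℝ) ≤ k := by exact_mod_cast hk
    nlinarith
  have h3 : (n : ℝ) / 2 - 2 * (k - 1)! ≤ ((n + 1) / 2 - 2 * (k - 1)! : ℕ) := by
    have : n ≤ 2 * ((n + 1) / 2 - 2 * (k - 1)!) + 4 * (k - 1)! := by omega
    have : (n : ℝ) ≤ 2 * ((n + 1) / 2 - 2 * (k - 1)! : ℕ) + 4 * (k - 1)! := by exact_mod_cast this
    linarith
  have h4 : s * n / 2 ≤ ((n + 1) / 2 - 2 * (k - 1)! : ℕ) := by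
    refine le_trans ?_ h3
    have : (4 : ℝ) / k * n ≤ (1 - s) * n := by gcongr
    have h5 : (4 : ℝ) / k * n = 4 * (n / k) := by ring
    linarith
  calc mu U ≤ mu (closure U) := measure_mono subset_closure
    _ = PP {w | w.1 ∈ (univ : Set Bt) ∧ XX w ∈ closure U} := by
        rw [mu_apply isClosed_closure.measurableSet]; simp [Set.preimage]
    _ ≤ 25 * (4⁻¹ : ℝ≥0∞) ^ ((n + 1) / 2 - 2 * (k - 1)!) :=
        PP_small univ MeasurableSet.univ n _ (free_all (hK1.trans hk) hk1 hk2.le) _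
          (by rwa [Metric.ediam_closure])
    _ ≤ _ := by
        gcongr
        have h6 := four_pow h4
        rwa [show 2 * (s * n / 2) = s * n by ring] at h6

open Filter Topology in
lemma lower_dim {s : ℝ} (hs0 : 0 < s) (hs : s < 1) (S : Set (ℝ × ℝ)) (hS : mu S = 1) :
    ENNReal.ofReal s ≤ dimH S := by
  obtain ⟨N, hN⟩ := frost hs
  have key : ((50⁻¹ : ℝ≥0∞) • mu) ≤ μH[s] := by
    refine Measure.le_hausdorffMeasure s _ (ENNReal.ofReal ((2 : ℝ)⁻¹ ^ N))
      (by rw [ENNReal.ofReal_pos]; positivity) fun U hU => ?_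
    rw [Measure.smul_apply, smul_eq_mul, mul_comm, ← div_eq_mul_inv]
    apply ENNReal.div_le_of_le_mul
    have hfin : Metric.ediam U ≠ ∞ := ne_top_of_le_ne_top ENNReal.ofReal_ne_top hU
    obtain ⟨δ, hδ0, hδ⟩ : ∃ δ : ℝ, 0 ≤ δ ∧ Metric.ediam U = ENNReal.ofReal δ :=
      ⟨(Metric.ediam U).toReal, ENNReal.toReal_nonneg, (ENNReal.ofReal_toReal hfin).symm⟩
    rcases hδ0.eq_or_lt with h0 | hpos
    · have hz : Metric.ediam U = 0 := by rw [hδ, ← h0]; simp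
      have hlim : Tendsto (fun n : ℕ => 25 * ENNReal.ofReal ((2 : ℝ) ^ (-(s * n)))) atTop (𝓝 0) := by
        have h1 : Tendsto (fun n : ℕ => ((2 : ℝ) ^ (-s)) ^ n) atTop (𝓝 0) :=
          tendsto_pow_atTop_nhds_zero_of_lt_one (by positivity)
            (Real.rpow_lt_one_of_one_lt_of_neg (by norm_num) (by linarith))
        have h2 := ENNReal.Tendsto.const_mul (a := 25) (ENNReal.tendsto_ofReal h1)
          (Or.inr (by simp))
        simp only [ENNReal.ofReal_zero, mul_zero] at h2
        refine h2.congr fun n => ?_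
        rw [← Real.rpow_natCast, ← Real.rpow_mul (by norm_num)]
        congr 3; ring
      have : mu U ≤ 0 := ge_of_tendsto hlim (eventually_atTop.2 ⟨N, fun n hn => hN n hn U (by simp [hz])⟩)
      exact this.trans zero_le
    · rw [hδ, ENNReal.ofReal_le_ofReal_iff (by positivity)] at hU
      obtain ⟨n, hn1, hn2⟩ := exists_nat_pow_near_of_lt_one (x := δ) (y := (2 : ℝ)⁻¹) hpos
        (hU.trans (pow_le_one₀ (by norm_num) (by norm_num))) (by norm_num) (by norm_num)
      have hNn : N < n + 1 := by
        by_contra hc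
        have := pow_le_pow_of_le_one (a := (2 : ℝ)⁻¹) (by norm_num) (by norm_num) (not_lt.1 hc)
        linarith
      refine (hN n (by omega) U (by rw [hδ]; exact ENNReal.ofReal_le_ofReal hn2)).trans ?_
      rw [hδ, ENNReal.ofReal_rpow_of_pos hpos]
      have h25 : (25 : ℝ≥0∞) = ENNReal.ofReal 25 := by norm_num
      have h50 : (50 : ℝ≥0∞) = ENNReal.ofReal 50 := by norm_num
      rw [h25, h50, ← ENNReal.ofReal_mul (by norm_num), ← ENNReal.ofReal_mul (by positivity)]
      apply ENNReal.ofReal_le_ofReal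
      have h1 : ((2 : ℝ)⁻¹ ^ (n + 1)) ^ s ≤ δ ^ s := Real.rpow_le_rpow (by positivity) hn1.le hs0.le
      have h2 : (2 : ℝ) ^ (-(s * n)) = 2 ^ s * ((2 : ℝ)⁻¹ ^ (n + 1)) ^ s := by
        rw [← Real.rpow_natCast, ← Real.rpow_neg_one, ← Real.rpow_mul (by norm_num),
          ← Real.rpow_mul (by norm_num), ← Real.rpow_add (by norm_num)]
        congr 1; push_cast; ring
      have h3 : (2 : ℝ) ^ s ≤ 2 := by
        calc (2 : ℝ) ^ s ≤ 2 ^ (1 : ℝ) := Real.rpow_le_rpow_of_exponent_le (by norm_num) hs.le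
          _ = 2 := by norm_num
      rw [h2]
      have h4 : (0 : ℝ) ≤ ((2 : ℝ)⁻¹ ^ (n + 1)) ^ s := by positivity
      nlinarith
  have h1 : μH[s] S ≠ 0 := by
    have h := key S
    rw [Measure.smul_apply, hS, smul_eq_mul, mul_one] at h
    intro hc
    rw [hc] at h
    simp at h
  have := le_dimH_of_hausdorffMeasure_ne_zero (d := s.toNNReal) (s := S)
    (by rwa [Real.coe_toNNReal _ hs0.le])
  exact this

def sq (k a b : ℕ) : Set (ℝ × ℝ) :=
  Icc ((a : ℝ) / 2 ^ (k !)) ((a : ℝ) / 2 ^ (k !) + (2⁻¹) ^ (2 * (k !))) ×ˢ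
  Icc ((b : ℝ) / 2 ^ (k !)) ((b : ℝ) / 2 ^ (k !) + (2⁻¹) ^ (2 * (k !)))

lemma ediam_sq (k a b : ℕ) : Metric.ediam (sq k a b) ≤ ENNReal.ofReal ((2⁻¹) ^ (2 * (k !))) := by
  apply Metric.ediam_le
  rintro x ⟨hx1, hx2⟩ y ⟨hy1, hy2⟩
  rw [Prod.edist_eq]
  apply max_le
  · refine (Metric.edist_le_ediam_of_mem hx1 hy1).trans ?_
    rw [Real.ediam_Icc]; simp
  · refine (Metric.edist_le_ediam_of_mem hx2 hy2).trans ?_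
    rw [Real.ediam_Icc]; simp

lemma mem_sq1 {c : Bt} {k : ℕ} (h : isBad c k) (b : Bt) : Real.ofDigits (msk c b) ∈
    Icc ((pref (msk c b) (k !) : ℝ) / 2 ^ (k !))
      ((pref (msk c b) (k !) : ℝ) / 2 ^ (k !) + (2⁻¹) ^ (2 * (k !))) := by
  have h1 := pref_zero (msk c b) (k !) (k !) (fun m hm hm' => by
    have : masked c m := ⟨k, h, hm, by omega⟩
    simp [msk, this])
  have h2 := val_bounds (msk c b) (k ! + k !)
  rw [h1] at h2
  push_cast at h2
  rw [pow_add, mul_assoc] at h2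
  have hp : (0 : ℝ) < 2 ^ (k !) := by positivity
  constructor
  · rw [div_le_iff₀ hp, mul_comm]
    exact le_of_mul_le_mul_left h2.1 hp
  · have : (2⁻¹ : ℝ) ^ (2 * (k !)) = 1 / (2 ^ (k !) * 2 ^ (k !)) := by
      rw [two_mul, pow_add, inv_pow]; field_simp
    rw [this, div_add_div _ _ (by positivity) (by positivity), le_div_iff₀ (by positivity)]
    nlinarith [h2.2]

def SS : Set (ℝ × ℝ) := (Icc (0 : ℝ) 1 ×ˢ Icc (0 : ℝ) 1) ∩
  ⋂ K : ℕ, ⋃ k : ℕ, ⋃ _ : K ≤ k, ⋃ a : Fin (2 ^ (k !)), ⋃ b : Fin (2 ^ (k !)), sq k a b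

lemma meas_SS : MeasurableSet SS := by
  refine (measurableSet_Icc.prod measurableSet_Icc).inter (MeasurableSet.iInter fun K =>
    MeasurableSet.iUnion fun k => MeasurableSet.iUnion fun _ => MeasurableSet.iUnion fun a =>
    MeasurableSet.iUnion fun b => measurableSet_Icc.prod measurableSet_Icc)

lemma XX_mem (w) : XX w ∈ Icc (0 : ℝ) 1 ×ˢ Icc (0 : ℝ) 1 :=
  ⟨⟨Real.ofDigits_nonneg _, Real.ofDigits_le_one _⟩, ⟨Real.ofDigits_nonneg _, Real.ofDigits_le_one _⟩⟩

lemma mu_SS : mu SS = 1 := by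
  rw [mu_apply meas_SS]
  have : XX ⁻¹' SS = univ := by
    refine eq_univ_of_forall fun w => ⟨XX_mem w, mem_iInter.2 fun K => ?_⟩
    obtain ⟨k, hk, hb⟩ := exists_bad w.1 K
    simp only [mem_iUnion]
    exact ⟨k, hk, ⟨_, pref_lt _ _⟩, ⟨_, pref_lt _ _⟩, mem_sq1 hb _, mem_sq1 hb _⟩
  rw [this, measure_univ]

open Filter Topology in
lemma dim_SS_le {s : ℝ} (hs : 1 < s) : dimH SS ≤ ENNReal.ofReal s := by
  classical
  have hs0 : 0 < s := by linarith
  have hq1 : (4 : ℝ) ^ (1 - s) < 1 := Real.rpow_lt_one_of_one_lt_of_neg (by norm_num) (by linarith)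
  have hq0 : (0 : ℝ) < (4 : ℝ) ^ (1 - s) := by positivity
  set q : ℝ := (4 : ℝ) ^ (1 - s) with hq
  let ι := Σ k : ℕ, Fin (2 ^ (k !)) × Fin (2 ^ (k !))
  let t : ℕ → ι → Set (ℝ × ℝ) := fun K i => if K ≤ i.1 then sq i.1 i.2.1 i.2.2 else ∅
  have hle : μH[s] SS ≤ liminf (fun K => ∑' i, Metric.ediam (t K i) ^ s) atTop := by
    refine Measure.hausdorffMeasure_le_liminf_tsum s SS
      (fun K => ENNReal.ofReal ((2⁻¹) ^ K)) ?_ t ?_ ?_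
    · have := ENNReal.tendsto_ofReal (tendsto_pow_atTop_nhds_zero_of_lt_one (r := (2⁻¹ : ℝ))
        (by norm_num) (by norm_num))
      simpa using this
    · refine Eventually.of_forall fun K i => ?_
      by_cases h : K ≤ i.1
      · simp only [t, h, if_true]
        refine (ediam_sq _ _ _).trans (ENNReal.ofReal_le_ofReal ?_)
        apply pow_le_pow_of_le_one (by norm_num) (by norm_num)
        have := Nat.self_le_factorial i.1
        omega
      · simp [t, h]
    · refine Eventually.of_forall fun K x hx => ?_
      have := mem_iInter.1 hx.2 K
      simp only [mem_iUnion] at this ⊢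
      obtain ⟨k, hk, a, b, h⟩ := this
      exact ⟨⟨k, a, b⟩, by simpa [t, hk] using h⟩
  have hbound : ∀ K, ∑' i, Metric.ediam (t K i) ^ s ≤ ENNReal.ofReal (∑' k : ℕ, q ^ k) := by
    intro K
    have h1 : ∀ i : ι, Metric.ediam (t K i) ^ s ≤
        ENNReal.ofReal (((2⁻¹ : ℝ) ^ (2 * (i.1 !))) ^ s) := by
      intro i
      by_cases h : K ≤ i.1
      · simp only [t, h, if_true]
        rw [← ENNReal.ofReal_rpow_of_pos (by positivity)]
        exact ENNReal.rpow_le_rpow (ediam_sq _ _ _) hs0.le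
      · simp [t, h, hs0]
    rw [ENNReal.ofReal_tsum_of_nonneg (fun k => by positivity)
      (summable_geometric_of_lt_one hq0.le hq1)]
    refine (ENNReal.tsum_le_tsum h1).trans ?_
    rw [ENNReal.tsum_sigma' (fun i : ι => ENNReal.ofReal (((2⁻¹ : ℝ) ^ (2 * (i.1 !))) ^ s))]
    refine ENNReal.tsum_le_tsum fun k => ?_
    simp only [tsum_fintype, Finset.sum_const, nsmul_eq_mul, Finset.card_univ, Fintype.card_prod,
      Fintype.card_fin]
    rw [← ENNReal.ofReal_natCast, ← ENNReal.ofReal_mul (by positivity)]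
    apply ENNReal.ofReal_le_ofReal
    have h2 : ((2 ^ k ! * 2 ^ k ! : ℕ) : ℝ) * ((2⁻¹ : ℝ) ^ (2 * (k !))) ^ s = q ^ (k !) := by
      have e1 : ((2 ^ k ! * 2 ^ k ! : ℕ) : ℝ) = (4 : ℝ) ^ ((k ! : ℕ) : ℝ) := by
        rw [Real.rpow_natCast]; push_cast; rw [← mul_pow]; norm_num
      have e2 : ((2⁻¹ : ℝ) ^ (2 * (k !))) = (4 : ℝ) ^ (-((k ! : ℕ) : ℝ)) := by
        rw [Real.rpow_neg (by norm_num), Real.rpow_natCast, pow_mul, ← inv_pow]; norm_num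
      rw [e1, e2, ← Real.rpow_mul (by norm_num), ← Real.rpow_add (by norm_num), hq,
        ← Real.rpow_natCast, ← Real.rpow_mul (by norm_num)]
      congr 1; ring
    rw [h2]
    exact pow_le_pow_of_le_one hq0.le hq1.le (Nat.self_le_factorial k)
  have hfin : μH[s] SS ≠ ∞ := by
    refine ne_top_of_le_ne_top (ENNReal.ofReal_ne_top (r := ∑' k : ℕ, q ^ k)) (hle.trans ?_)
    refine (liminf_le_liminf (Eventually.of_forall hbound)).trans ?_
    simp
  exact dimH_le_of_hausdorffMeasure_ne_top (d := s.toNNReal) (s := SS)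
    (by rwa [Real.coe_toNNReal _ hs0.le])

lemma dim_SS : dimH SS ≤ 1 := by
  apply le_of_forall_gt_imp_ge_of_dense
  intro a ha
  by_cases h : a = ∞
  · simp [h]
  · have := dim_SS_le (s := a.toReal) (by
      rw [← ENNReal.toReal_one]; exact (ENNReal.toReal_lt_toReal (by simp) h).2 ha)
    rwa [ENNReal.ofReal_toReal h] at this

lemma dim_ge (S : Set (ℝ × ℝ)) (hS : mu S = 1) : 1 ≤ dimH S := by
  apply le_of_forall_lt_imp_le_of_dense
  intro a ha
  by_cases h : a = 0
  · simp [h]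
  · have ht : a ≠ ∞ := ne_top_of_lt ha
    have := lower_dim (s := a.toReal) (ENNReal.toReal_pos h ht) (by
      rw [← ENNReal.toReal_one]; exact (ENNReal.toReal_lt_toReal ht (by simp)).2 ha) S hS
    rwa [ENNReal.ofReal_toReal ht] at this

lemma box_bound {k n : ℕ} (hk : 1 ≤ k) (hk1 : k ! ≤ n) (hk2 : n < (k + 1)!) (A : Set (ℝ × ℝ))
    (hA : MeasurableSet A) (𝒰 : Finset (Set (ℝ × ℝ)))
    (hU : ∀ U ∈ 𝒰, Metric.ediam U ≤ ENNReal.ofReal ((2 : ℝ)⁻¹ ^ n))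
    (hcov : A ⊆ ⋃₀ (𝒰 : Set (Set (ℝ × ℝ)))) :
    (mu A).toReal ≤ 2 / k + 𝒰.card * (25 * (2 : ℝ) ^ (-((2 - 4 / (k : ℝ)) * n))) := by
  have hk0 : (0 : ℝ) < k := by exact_mod_cast hk
  have hsub : XX ⁻¹' A ⊆ ({c | isBad c k} ×ˢ univ) ∪
      ⋃ U ∈ 𝒰, {w | w.1 ∈ {c | ¬ isBad c k} ∧ XX w ∈ U} := by
    intro w hw
    by_cases h : isBad w.1 k
    · exact Or.inl ⟨h, mem_univ _⟩
    · obtain ⟨U, hU, hwU⟩ := hcov hw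
      right
      simp only [mem_iUnion]
      exact ⟨U, hU, h, hwU⟩
  have h1 : PP ({c | isBad c k} ×ˢ univ) ≤ ENNReal.ofReal (2 / k) := by
    rw [PP, Measure.prod_prod, measure_univ, mul_one]
    refine (PB_bad k).trans ?_
    have : (2⁻¹ : ℝ≥0∞) ^ (Nat.log 2 k) = ENNReal.ofReal ((2⁻¹ : ℝ) ^ (Nat.log 2 k)) := by
      rw [ENNReal.ofReal_pow (by norm_num), ENNReal.ofReal_inv_of_pos (by norm_num)]; norm_num
    rw [this]
    apply ENNReal.ofReal_le_ofReal
    have h2 : k < 2 ^ (Nat.log 2 k + 1) := Nat.lt_pow_succ_log_self (by norm_num) k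
    have h3 : (k : ℝ) < 2 ^ (Nat.log 2 k) * 2 := by rw [← pow_succ]; exact_mod_cast h2
    rw [inv_pow, inv_eq_one_div, div_le_div_iff₀ (by positivity) hk0]
    linarith
  have hf := fact_le_div hk hk1
  have h3 : (2 - 4 / (k : ℝ)) * n / 2 ≤ ((n - 2 * (k - 1)! : ℕ) : ℝ) := by
    have : n ≤ (n - 2 * (k - 1)!) + 2 * (k - 1)! := by omega
    have : (n : ℝ) ≤ (n - 2 * (k - 1)! : ℕ) + 2 * (k - 1)! := by exact_mod_cast this
    have h5 : (2 - 4 / (k : ℝ)) * n / 2 = (n : ℝ) - 2 * (n / k) := by ring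
    linarith
  have h4 : ∀ U ∈ 𝒰, PP {w | w.1 ∈ {c | ¬ isBad c k} ∧ XX w ∈ U} ≤
      ENNReal.ofReal (25 * (2 : ℝ) ^ (-((2 - 4 / (k : ℝ)) * n))) := by
    intro U hUm
    refine (PP_small {c | ¬ isBad c k} (meas_bad k).compl n _ (free_good hk hk2.le) U (hU U hUm)).trans ?_
    rw [ENNReal.ofReal_mul (by norm_num)]
    have h25 : (25 : ℝ≥0∞) = ENNReal.ofReal 25 := by norm_num
    rw [← h25]
    gcongr
    have h6 := four_pow h3
    rwa [show 2 * ((2 - 4 / (k : ℝ)) * n / 2) = (2 - 4 / (k : ℝ)) * n by ring] at h6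
  have h5 : mu A ≤ ENNReal.ofReal (2 / k + 𝒰.card * (25 * (2 : ℝ) ^ (-((2 - 4 / (k : ℝ)) * n)))) := by
    rw [mu_apply hA]
    refine (measure_mono hsub).trans ((measure_union_le _ _).trans ?_)
    rw [ENNReal.ofReal_add (by positivity) (by positivity)]
    refine add_le_add h1 ((measure_biUnion_finset_le _ _).trans ((Finset.sum_le_sum h4).trans ?_))
    rw [Finset.sum_const, nsmul_eq_mul, ENNReal.ofReal_mul (p := (𝒰.card : ℝ)) (by positivity),
      ENNReal.ofReal_natCast]
  exact ENNReal.toReal_le_of_le_ofReal (by positivity) h5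

end Constr

theorem exists_measure_hdim_one_lower_mod_box_dim_two :
    ∃ μ : Measure (ℝ × ℝ), IsProbabilityMeasure μ ∧
      μ (Set.Icc (0 : ℝ) 1 ×ˢ Set.Icc (0 : ℝ) 1)ᶜ = 0 ∧
      (⨅ (S : Set (ℝ × ℝ)) (_ : MeasurableSet S)
          (_ : S ⊆ Set.Icc (0 : ℝ) 1 ×ˢ Set.Icc (0 : ℝ) 1) (_ : μ S = 1), dimH S) = 1 ∧
      (∀ A : Set (ℝ × ℝ), MeasurableSet A → A ⊆ Set.Icc (0 : ℝ) 1 ×ˢ Set.Icc (0 : ℝ) 1 →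
        0 < μ A → ∀ ε : ℝ, 0 < ε → ε < 2 → ∃ n₀ : ℕ, ∀ n : ℕ, n₀ ≤ n →
          ∀ 𝒰 : Finset (Set (ℝ × ℝ)),
            (∀ U ∈ 𝒰, EMetric.diam U ≤ ENNReal.ofReal ((2 : ℝ) ^ (-(n : ℝ)))) →
            A ⊆ ⋃₀ (𝒰 : Set (Set (ℝ × ℝ))) →
            (2 : ℝ) ^ ((2 - ε) * n) ≤ (𝒰.card : ℝ)) := by
  refine ⟨Constr.mu, inferInstance, ?_, ?_, ?_⟩
  · rw [Constr.mu_apply (measurableSet_Icc.prod measurableSet_Icc).compl]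
    have : Constr.XX ⁻¹' (Set.Icc (0 : ℝ) 1 ×ˢ Set.Icc (0 : ℝ) 1)ᶜ = ∅ := by
      ext w
      simp only [mem_preimage, mem_compl_iff, Constr.XX_mem w, not_true, mem_empty_iff_false]
    rw [this, measure_empty]
  · apply le_antisymm
    · exact (iInf₂_le Constr.SS Constr.meas_SS).trans
        ((iInf₂_le inter_subset_left Constr.mu_SS).trans Constr.dim_SS)
    · exact le_iInf₂ fun S _ => le_iInf₂ fun _ h => Constr.dim_ge S h
  · intro A hA _ hpos ε hε _
    set a := (Constr.mu A).toReal with ha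
    have ha0 : 0 < a := ENNReal.toReal_pos hpos.ne' (measure_ne_top _ _)
    obtain ⟨K, hK⟩ := exists_nat_gt (max (4 / a) (8 / ε))
    have hK1 := (le_max_left _ _).trans_lt hK
    have hK2 := (le_max_right _ _).trans_lt hK
    have hK0 : (0 : ℝ) < K := lt_trans (by positivity) hK1
    have hlim : Filter.Tendsto (fun n : ℕ => ((2 : ℝ) ^ (ε / 2)) ^ n) Filter.atTop Filter.atTop :=
      tendsto_pow_atTop_atTop_of_one_lt (Real.one_lt_rpow (by norm_num) (by positivity))
    obtain ⟨M, hM⟩ := Filter.eventually_atTop.1 (hlim.eventually_ge_atTop (50 / a))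
    refine ⟨max (Nat.factorial K) M, fun n hn 𝒰 hU hcov => ?_⟩
    obtain ⟨k, hk, hk1, hk2⟩ := Constr.exists_fact ((le_max_left _ _).trans hn)
    have hKk : (K : ℝ) ≤ k := by exact_mod_cast hk
    have hk0 : (0 : ℝ) < k := hK0.trans_le hKk
    have hb := Constr.box_bound (by exact_mod_cast hk0) hk1 hk2 A hA 𝒰 (fun U h => by
      have := hU U h
      rwa [Real.rpow_neg (by norm_num), Real.rpow_natCast, ← inv_pow] at this) hcov
    rw [← ha] at hb
    have h1 : (2 : ℝ) / k ≤ a / 2 := by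
      rw [div_lt_iff₀ ha0] at hK1
      rw [div_le_div_iff₀ hk0 (by norm_num)]
      nlinarith
    have h2 : (4 : ℝ) / k ≤ ε / 2 := by
      rw [div_lt_iff₀ hε] at hK2
      rw [div_le_div_iff₀ hk0 (by norm_num)]
      nlinarith
    have h3 : (2 : ℝ) ^ (-((2 - 4 / (k : ℝ)) * n)) ≤ 2 ^ (-((2 - ε / 2) * n)) := by
      apply Real.rpow_le_rpow_of_exponent_le (by norm_num)
      have : (4 : ℝ) / k * n ≤ ε / 2 * n := by gcongr
      linarith
    have h4 := hM n ((le_max_right _ _).trans hn)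
    rw [← Real.rpow_natCast, ← Real.rpow_mul (by norm_num), div_le_iff₀ ha0] at h4
    have h5 : a / 2 ≤ 𝒰.card * (25 * (2 : ℝ) ^ (-((2 - ε / 2) * n))) := by
      have : (𝒰.card : ℝ) * (25 * (2 : ℝ) ^ (-((2 - 4 / (k : ℝ)) * n))) ≤
        𝒰.card * (25 * (2 : ℝ) ^ (-((2 - ε / 2) * n))) := by gcongr
      linarith
    have h6 : (2 : ℝ) ^ (-((2 - ε / 2) * n)) * 2 ^ ((2 - ε) * n) * 2 ^ (ε / 2 * n) = 1 := by
      rw [← Real.rpow_add (by norm_num), ← Real.rpow_add (by norm_num)]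
      have : -((2 - ε / 2) * n) + (2 - ε) * n + ε / 2 * n = 0 := by ring
      rw [this, Real.rpow_zero]
    set x := (2 : ℝ) ^ (-((2 - ε / 2) * n)) with hx
    set y := (2 : ℝ) ^ ((2 - ε) * n) with hy
    set z := (2 : ℝ) ^ (ε / 2 * n) with hz
    have hx0 : 0 < x := by positivity
    have hy0 : 0 < y := by positivity
    have hz0 : 0 < z := by positivity
    -- a ≤ 50 c x,  50 ≤ z a,  x y z = 1
    have h7 : 1 ≤ z * 𝒰.card * x := by
      have : z * a ≤ z * (50 * (𝒰.card * x)) := by gcongr; linarith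
      nlinarith
    have h8 : y * 1 ≤ y * (z * 𝒰.card * x) := by gcongr
    calc y = y * 1 := by ring
      _ ≤ y * (z * 𝒰.card * x) := h8
      _ = 𝒰.card * (x * y * z) := by ring
      _ = 𝒰.card := by rw [h6, mul_one]
end
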